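/- Let p, p₀, p₁ ∈ (1,∞) and 1 ≤ q ≤ ∞, with conjugate exponents p′ and q′ (1/p + 1/p′ = 1, 1/q + 1/q′ = 1). Then there is a constant C > 0 such that for all Schwartz functions f, g, h on ℝ, the trilinear Hilbert transform satisfies ‖TH(f,g,h)‖_{M^{p₀,∞}} ≤ C · ‖f‖_{M^{p₁,1}} · ‖g‖_{M^{p,q}} · ‖h‖_{M^{p′,q′}}. -/

import Mathlib

open MeasureTheory Complex
open scoped ENNReal NNReal

noncomputable section

/-- `e2pi a = e^{2πi a}`. -/
def e2pi (a : ℝ) : ℂ := Complex.exp (2 * Real.pi * Complex.I * (a : ℂ))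

/-- Short-time Fourier transform on `ℝ`: `V_φ f (t, ν)`. -/
def STFT1 (φ f : ℝ → ℂ) (t ν : ℝ) : ℂ := ∫ y : ℝ, f y * e2pi (-(y * ν)) * φ (y - t)

/-- The Gaussian window `e^{-x²}` on `ℝ`. -/
def gauss1 : ℝ → ℂ := fun x => (Real.exp (-x ^ 2) : ℝ)

/-- `L^p`-type norm (`ℝ≥0∞`-valued) with essential supremum in case `p = ∞`. -/
def eNorm {α : Type*} [MeasurableSpace α] (μ : Measure α) (p : ℝ≥0∞) (F : α → ℝ≥0∞) : ℝ≥0∞ :=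
  if p = ∞ then essSup F μ else (∫⁻ a, F a ^ p.toReal ∂μ) ^ (1 / p.toReal)

/-- Modulation space norm `‖f‖_{M^{p,q}}` on `ℝ` with the Gaussian window. -/
def modNorm1 (p q : ℝ≥0∞) (f : ℝ → ℂ) : ℝ≥0∞ :=
  eNorm volume q fun ν => eNorm volume p fun t => (‖STFT1 gauss1 f t ν‖₊ : ℝ≥0∞)

/-- Fourier transform on `ℝ`. -/
def FT1 (f : ℝ → ℂ) (ξ : ℝ) : ℂ := ∫ y : ℝ, f y * e2pi (-(y * ξ))

/-- Symbol short-time Fourier transform of a symbol on `ℝ³`. -/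
def symbSTFT3 (Ψ σ : ℝ × ℝ × ℝ → ℂ) (x t₁ t₂ ξ₁ ξ₂ ν : ℝ) : ℂ :=
  ∫ X : ℝ × ℝ × ℝ, σ X * Ψ (X.1 - x, X.2.1 - ξ₁, X.2.2 - ξ₂) *
    e2pi (-(X.1 * ν - t₁ * X.2.1 - t₂ * X.2.2))

/-- Symbol short-time Fourier transform of a symbol on `ℝ⁴`. -/
def symbSTFT4 (Ψ σ : ℝ × ℝ × ℝ × ℝ → ℂ) (x t₁ t₂ t₃ ξ₁ ξ₂ ξ₃ ν : ℝ) : ℂ :=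
  ∫ X : ℝ × ℝ × ℝ × ℝ, σ X * Ψ (X.1 - x, X.2.1 - ξ₁, X.2.2.1 - ξ₂, X.2.2.2 - ξ₃) *
    e2pi (-(X.1 * ν - t₁ * X.2.1 - t₂ * X.2.2.1 - t₃ * X.2.2.2))

/-- The bilinear Hilbert transform as an (absolutely convergent) bilinear Fourier
multiplier for Schwartz functions. -/
def BH (f g : ℝ → ℂ) (x : ℝ) : ℂ :=
  ∫ ξ : ℝ × ℝ, (-(Real.pi : ℂ) * Complex.I * (Real.sign (ξ.1 - ξ.2) : ℝ)) *
    FT1 f ξ.1 * FT1 g ξ.2 * e2pi (x * (ξ.1 + ξ.2))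

/-- The trilinear Hilbert transform as an (absolutely convergent) trilinear Fourier
multiplier for Schwartz functions. -/
def TH (f g h : ℝ → ℂ) (x : ℝ) : ℂ :=
  ∫ ξ : ℝ × ℝ × ℝ, ((Real.pi : ℂ) * Complex.I * (Real.sign (ξ.1 - ξ.2.1 - 2 * ξ.2.2) : ℝ)) *
    FT1 f ξ.1 * FT1 g ξ.2.1 * FT1 h ξ.2.2 * e2pi (x * (ξ.1 + ξ.2.1 + ξ.2.2))

theorem norm_e2pi (a : ℝ) : ‖e2pi a‖ = 1 := by
  have : (2 * Real.pi * Complex.I * (a : ℂ)) = ((2 * Real.pi * a : ℝ) : ℂ) * Complex.I := by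
    push_cast; ring
  rw [e2pi, this, Complex.norm_exp_ofReal_mul_I]

theorem enorm_e2pi (a : ℝ) : ‖e2pi a‖ₑ = 1 := by
  rw [← ofReal_norm, norm_e2pi, ENNReal.ofReal_one]

theorem e2pi_add (a b : ℝ) : e2pi (a + b) = e2pi a * e2pi b := by
  simp only [e2pi]; rw [← Complex.exp_add]; push_cast; ring_nf

@[fun_prop]
theorem continuous_e2pi : Continuous e2pi := by
  unfold e2pi; fun_prop

/-- The Gaussian `e^{-bx²}`. -/
def gaus (b x : ℝ) : ℂ := (Real.exp (-b * x ^ 2) : ℝ)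

theorem gauss1_eq : gauss1 = gaus 1 := by
  funext x; simp [gauss1, gaus]

@[fun_prop]
theorem continuous_gaus (b : ℝ) : Continuous (gaus b) := by
  unfold gaus; fun_prop

theorem norm_gaus (b x : ℝ) : ‖gaus b x‖ = Real.exp (-b * x ^ 2) := by
  rw [gaus, Complex.norm_real, Real.norm_eq_abs, abs_of_pos (Real.exp_pos _)]

theorem norm_gaus_le {b : ℝ} (hb : 0 ≤ b) (x : ℝ) : ‖gaus b x‖ ≤ 1 := by
  rw [norm_gaus, Real.exp_le_one_iff]
  nlinarith [sq_nonneg x, mul_nonneg hb (sq_nonneg x)]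

theorem integrable_gaus {b : ℝ} (hb : 0 < b) : Integrable (gaus b) := by
  unfold gaus
  exact (integrable_exp_neg_mul_sq hb).ofReal

theorem integral_gaus (b : ℝ) : ∫ x, gaus b x = (√(Real.pi / b) : ℝ) := by
  unfold gaus
  rw [integral_complex_ofReal, integral_gaussian]

theorem gaus_neg (b x : ℝ) : gaus b (-x) = gaus b x := by simp [gaus]

theorem integral_gaus_e2pi {b : ℝ} (hb : 0 < b) (ω : ℝ) :
    ∫ x, gaus b x * e2pi (x * ω) = (√(Real.pi / b) : ℝ) * gaus (Real.pi ^ 2 / b) ω := by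
  have h := fourierIntegral_gaussian (b := (b : ℂ)) (by simpa using hb) (2 * Real.pi * ω)
  have e1 : ∀ x : ℝ, gaus b x * e2pi (x * ω) =
      cexp (I * (2 * Real.pi * ω) * x) * cexp (-(b : ℂ) * (x : ℂ) ^ 2) := by
    intro x
    simp only [gaus, e2pi]
    push_cast
    rw [mul_comm]
    congr 2
    ring
  simp_rw [e1]
  rw [h]
  congr 1
  · rw [Real.sqrt_eq_rpow, Complex.ofReal_cpow (by positivity)]
    push_cast
    rfl
  · simp only [gaus]
    push_cast
    congr 1
    have : (b : ℂ) ≠ 0 := by exact_mod_cast hb.ne'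
    field_simp
    ring

/-- Convolution of two Gaussians. -/
theorem gaus_conv {a b : ℝ} (ha : 0 < a) (hb : 0 < b) (x z : ℝ) :
    ∫ y, gaus a (x - y) * gaus b (y - z) =
      (√(Real.pi / (a + b)) : ℝ) * gaus (a * b / (a + b)) (x - z) := by
  have hab : a + b ≠ 0 := by positivity
  have e : ∀ y, gaus a (x - y) * gaus b (y - z) =
      gaus (a * b / (a + b)) (x - z) * gaus (a + b) (y - (a * x + b * z) / (a + b)) := by
    intro y
    simp only [gaus]
    rw [← Complex.ofReal_mul, ← Complex.ofReal_mul, ← Real.exp_add, ← Real.exp_add]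
    congr 2
    field_simp
    ring
  simp_rw [e]
  rw [integral_const_mul, integral_sub_right_eq_self (gaus (a + b)), integral_gaus, mul_comm]

/-- Superposition: integrating against an inverse Fourier integral. -/
theorem integral_mul_superposition {Z : Type*} [MeasurableSpace Z] {μ : Measure Z} [SFinite μ]
    {Θ : Z → ℂ} (hΘ : Integrable Θ μ) {a : ℝ → ℂ} (ha : Integrable a) {E : Z → ℝ}
    (hE : Measurable E) :
    ∫ z, Θ z * (∫ ν, a ν * e2pi (E z * ν)) ∂μ =
      ∫ ν, a ν * (∫ z, Θ z * e2pi (E z * ν) ∂μ) := by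
  have hprod : Integrable (Function.uncurry fun z ν => Θ z * (a ν * e2pi (E z * ν)))
      (μ.prod volume) := by
    have h1 := hΘ.mul_prod ha
    have h2 : Measurable fun w : Z × ℝ => e2pi (E w.1 * w.2) :=
      continuous_e2pi.measurable.comp ((hE.comp measurable_fst).mul measurable_snd)
    have h3 := h1.mul_bdd (c := 1) h2.aestronglyMeasurable
      (Filter.Eventually.of_forall fun w => (norm_e2pi _).le)
    refine h3.congr (Filter.Eventually.of_forall fun w => ?_)
    simp only [Function.uncurry]
    ring
  simp_rw [← integral_const_mul]
  rw [integral_integral_swap hprod]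
  refine integral_congr_ae (Filter.Eventually.of_forall fun ν => ?_)
  refine integral_congr_ae (Filter.Eventually.of_forall fun z => ?_)
  dsimp only
  ring

/-- `A` is the (absolutely convergent) inverse Fourier integral of `a`. -/
structure IsInvFT (a A : ℝ → ℂ) : Prop where
  integrable : Integrable a
  eq_integral : ∀ z, A z = ∫ ν, a ν * e2pi (z * ν)

theorem IsInvFT.norm_le {a A : ℝ → ℂ} (h : IsInvFT a A) (z : ℝ) : ‖A z‖ ≤ ∫ ν, ‖a ν‖ := by
  rw [h.eq_integral]
  refine (norm_integral_le_integral_norm _).trans (le_of_eq ?_)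
  simp [norm_e2pi]

theorem IsInvFT.continuous {a A : ℝ → ℂ} (h : IsInvFT a A) : Continuous A := by
  have : A = fun z => ∫ ν, a ν * e2pi (z * ν) := funext h.eq_integral
  rw [this]
  refine continuous_of_dominated (bound := fun ν => ‖a ν‖) ?_ ?_ h.integrable.norm ?_
  · intro z
    exact h.integrable.aestronglyMeasurable.mul
      (by fun_prop : Continuous fun ν => e2pi (z * ν)).aestronglyMeasurable
  · intro z
    exact Filter.Eventually.of_forall fun ν => by simp [norm_e2pi]
  · exact Filter.Eventually.of_forall fun ν => by fun_prop

theorem FT1_eq_fourier (f : ℝ → ℂ) : FT1 f = FourierTransform.fourier f := by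
  funext ξ
  rw [FT1, Real.fourier_eq']
  refine integral_congr_ae (Filter.Eventually.of_forall fun y => ?_)
  simp only [e2pi, smul_eq_mul]
  rw [mul_comm]
  congr 2
  simp
  ring

theorem isInvFT_of_integrable {A : ℝ → ℂ} (hc : Continuous A) (hA : Integrable A)
    (h : Integrable (FT1 A)) : IsInvFT (FT1 A) A := by
  refine ⟨h, fun z => ?_⟩
  rw [FT1_eq_fourier] at h ⊢
  have := congrFun (hc.fourierInv_fourier_eq hA h) z
  rw [Real.fourierInv_eq'] at this
  rw [← this]
  refine integral_congr_ae (Filter.Eventually.of_forall fun y => ?_)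
  simp only [e2pi, smul_eq_mul]
  rw [mul_comm]
  congr 2
  simp
  ring

theorem isInvFT_schwartz (f : SchwartzMap ℝ ℂ) : IsInvFT (FT1 f) f := by
  refine isInvFT_of_integrable f.continuous f.integrable ?_
  rw [FT1_eq_fourier, ← SchwartzMap.fourier_coe]
  exact SchwartzMap.integrable _

theorem FT1_gaus {b : ℝ} (hb : 0 < b) :
    FT1 (gaus b) = fun ξ => (√(Real.pi / b) : ℝ) * gaus (Real.pi ^ 2 / b) ξ := by
  funext ξ
  have := integral_gaus_e2pi hb (-ξ)
  rw [gaus_neg] at this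
  rw [← this, FT1]
  simp

theorem isInvFT_gaus {b : ℝ} (hb : 0 < b) : IsInvFT (FT1 (gaus b)) (gaus b) := by
  refine isInvFT_of_integrable (continuous_gaus b) (integrable_gaus hb) ?_
  rw [FT1_gaus hb]
  exact (integrable_gaus (by positivity)).const_mul _

/-- Pointwise products of inverse Fourier integrals are inverse Fourier integrals. -/
theorem isInvFT_mul {a A b B : ℝ → ℂ} (hA : IsInvFT a A) (hAi : Integrable A) (hB : IsInvFT b B)
    (hb : Integrable (FT1 A)) :
    IsInvFT (FT1 fun y => A y * B y) fun y => A y * B y := by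
  refine isInvFT_of_integrable (hA.continuous.mul hB.continuous)
    (hAi.mul_bdd hB.continuous.aestronglyMeasurable (Filter.Eventually.of_forall hB.norm_le)) ?_
  have e : (FT1 fun y => A y * B y) = fun ξ => ∫ ν, b ν * FT1 A (ξ - ν) := by
    funext ξ
    have := integral_mul_superposition (μ := volume) (Θ := fun y => A y * e2pi (-(y * ξ)))
      (hAi.mul_bdd (c := 1) (by fun_prop : Continuous fun y => e2pi (-(y * ξ))).aestronglyMeasurable
        (Filter.Eventually.of_forall fun w => (norm_e2pi _).le)) hB.integrable measurable_id
    simp only [id] at this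
    calc _ = ∫ z, A z * e2pi (-(z * ξ)) * ∫ ν, b ν * e2pi (z * ν) := by
          rw [FT1]
          refine integral_congr_ae (Filter.Eventually.of_forall fun y => ?_)
          dsimp only
          rw [← hB.eq_integral]; ring
      _ = _ := by
          rw [this]
          refine integral_congr_ae (Filter.Eventually.of_forall fun ν => ?_)
          simp only [FT1]
          congr 1
          refine integral_congr_ae (Filter.Eventually.of_forall fun y => ?_)
          dsimp only
          rw [mul_assoc, ← e2pi_add]
          congr 2
          ring
  rw [e]
  exact (hB.integrable.convolution_integrand (ContinuousLinearMap.mul ℝ ℂ) hb).integral_prod_left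

theorem IsInvFT.translate {a A : ℝ → ℂ} (h : IsInvFT a A) (t : ℝ) :
    IsInvFT (fun ν => a ν * e2pi (-(t * ν))) fun y => A (y - t) := by
  refine ⟨h.integrable.mul_bdd (c := 1)
    (by fun_prop : Continuous fun ν => e2pi (-(t * ν))).aestronglyMeasurable
    (Filter.Eventually.of_forall fun w => (norm_e2pi _).le), fun z => ?_⟩
  rw [h.eq_integral]
  refine integral_congr_ae (Filter.Eventually.of_forall fun ν => ?_)
  dsimp only
  rw [mul_assoc, ← e2pi_add]
  congr 2
  ring

/-- The short-time Fourier transform of a Schwartz function inverts the windowed function. -/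
theorem isInvFT_STFT (f : SchwartzMap ℝ ℂ) {b : ℝ} (hb : 0 < b) (t : ℝ) :
    IsInvFT (STFT1 (gaus b) f t) fun y => f y * gaus b (y - t) := by
  have h := isInvFT_mul (isInvFT_schwartz f) f.integrable ((isInvFT_gaus hb).translate t)
    (isInvFT_schwartz f).integrable
  have e : STFT1 (gaus b) f t = FT1 fun y => f y * gaus b (y - t) := by
    funext ν
    simp only [STFT1, FT1]
    refine integral_congr_ae (Filter.Eventually.of_forall fun y => ?_)
    dsimp only
    ring
  rw [e]
  exact h

theorem stronglyMeasurable_STFT (f : ℝ → ℂ) (hf : Measurable f) (b : ℝ) :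
    StronglyMeasurable (Function.uncurry (STFT1 (gaus b) f)) := by
  have h : StronglyMeasurable (Function.uncurry fun (z : ℝ × ℝ) (y : ℝ) =>
      f y * e2pi (-(y * z.2)) * gaus b (y - z.1)) := by
    refine Measurable.stronglyMeasurable ?_
    refine ((hf.comp measurable_snd).mul (Continuous.measurable ?_)).mul (Continuous.measurable ?_)
    · fun_prop
    · fun_prop
  exact h.integral_prod_right

/-- Changing the window: a short-time Fourier transform against a wider Gaussian is an average
of short-time Fourier transforms against a narrower one. -/
theorem STFT_widen {F : ℝ → ℂ} (hF : Measurable F) {M : ℝ} (hM : ∀ x, ‖F x‖ ≤ M) {a b : ℝ}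
    (ha : 0 < a) (hb : 0 < b) (t ν : ℝ) :
    (√(Real.pi / (a + b)) : ℝ) * STFT1 (gaus (a * b / (a + b))) F t ν =
      ∫ y, gaus b (y - t) * STFT1 (gaus a) F y ν := by
  have hprod : Integrable (Function.uncurry fun x y =>
      F x * e2pi (-(x * ν)) * (gaus a (x - y) * gaus b (y - t))) (volume.prod volume) := by
    have h1 := (((integrable_gaus hb).comp_sub_right t).convolution_integrand
      (ContinuousLinearMap.mul ℝ ℂ) (integrable_gaus ha) (μ := volume))
    refine (h1.bdd_mul (c := M) (f := fun z : ℝ × ℝ => F z.1 * e2pi (-(z.1 * ν)))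
      ((hF.comp measurable_fst).mul (by fun_prop :
        Continuous fun z : ℝ × ℝ => e2pi (-(z.1 * ν))).measurable).aestronglyMeasurable
      (Filter.Eventually.of_forall fun w => ?_)).congr (Filter.Eventually.of_forall fun w => ?_)
    · rw [norm_mul, norm_e2pi, mul_one]; exact hM _
    · simp only [Function.uncurry, ContinuousLinearMap.mul_apply']; ring
  calc _ = ∫ x, ∫ y, F x * e2pi (-(x * ν)) * (gaus a (x - y) * gaus b (y - t)) := by
        rw [STFT1, ← integral_const_mul]
        refine integral_congr_ae (Filter.Eventually.of_forall fun x => ?_)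
        dsimp only
        rw [integral_const_mul, gaus_conv ha hb]
        ring
    _ = _ := by
        rw [integral_integral_swap hprod]
        refine integral_congr_ae (Filter.Eventually.of_forall fun y => ?_)
        simp only [STFT1]
        rw [← integral_const_mul]
        refine integral_congr_ae (Filter.Eventually.of_forall fun x => ?_)
        dsimp only
        ring

theorem enorm_STFT_widen_le {F : ℝ → ℂ} (hF : Measurable F) {M : ℝ} (hM : ∀ x, ‖F x‖ ≤ M)
    {a b : ℝ} (ha : 0 < a) (hb : 0 < b) (t ν : ℝ) :
    ‖STFT1 (gaus (a * b / (a + b))) F t ν‖ₑ ≤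
      ENNReal.ofReal (√(Real.pi / (a + b)))⁻¹ *
        ∫⁻ y, ‖gaus b (y - t)‖ₑ * ‖STFT1 (gaus a) F y ν‖ₑ := by
  have hc : 0 < √(Real.pi / (a + b)) := Real.sqrt_pos.2 (div_pos Real.pi_pos (by positivity))
  have h : STFT1 (gaus (a * b / (a + b))) F t ν = ((√(Real.pi / (a + b)))⁻¹ : ℝ) *
      ∫ y, gaus b (y - t) * STFT1 (gaus a) F y ν := by
    rw [← STFT_widen hF hM ha hb, ← mul_assoc, ← Complex.ofReal_mul, inv_mul_cancel₀ hc.ne']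
    simp
  rw [h, enorm_mul]
  gcongr
  · rw [← ofReal_norm, Complex.norm_real, Real.norm_of_nonneg (inv_nonneg.2 hc.le)]
  · refine (enorm_integral_le_lintegral_enorm _).trans (le_of_eq ?_)
    simp_rw [enorm_mul]

/-- Smooth truncation of the kernel `1/s`. -/
def truncKer (α β s : ℝ) : ℂ := ((s / (s ^ 2 + α ^ 2) - s / (s ^ 2 + β ^ 2) : ℝ) : ℂ)

/-- Fourier multiplier of `truncKer`. -/
def truncSymb (α β η : ℝ) : ℂ :=
  if 0 ≤ η then Real.pi * I * (cexp (-(2 * Real.pi * α) * η) - cexp (-(2 * Real.pi * β) * η))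
  else -(Real.pi * I) * (cexp ((2 * Real.pi * α) * η) - cexp ((2 * Real.pi * β) * η))

theorem continuous_truncSymb (α β : ℝ) : Continuous (truncSymb α β) := by
  unfold truncSymb
  refine Continuous.if_le (by fun_prop) (by fun_prop) continuous_const continuous_id ?_
  intro x hx
  have : x = 0 := by simpa using hx.symm
  subst this
  simp

theorem norm_truncSymb_le {α β : ℝ} (hα : 0 < α) (hβ : 0 < β) (η : ℝ) :
    ‖truncSymb α β η‖ ≤ Real.pi := by
  have key : ∀ x y : ℝ, x ≤ 0 → y ≤ 0 → ‖cexp (x : ℂ) - cexp (y : ℂ)‖ ≤ 1 := by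
    intro x y hx hy
    rw [← Complex.ofReal_exp, ← Complex.ofReal_exp, ← Complex.ofReal_sub, Complex.norm_real,
      Real.norm_eq_abs, abs_le]
    have h1 := Real.exp_pos x
    have h2 := Real.exp_pos y
    have h3 := Real.exp_le_one_iff.2 hx
    have h4 := Real.exp_le_one_iff.2 hy
    constructor <;> linarith
  have hpi := Real.pi_pos
  have hnorm : ‖(Real.pi : ℂ) * I‖ = Real.pi := by simp [abs_of_pos hpi]
  have hA : 0 ≤ 2 * Real.pi * α := by positivity
  have hB : 0 ≤ 2 * Real.pi * β := by positivity
  unfold truncSymb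
  split_ifs with h
  · rw [norm_mul, hnorm]
    have := key (-(2 * Real.pi * α) * η) (-(2 * Real.pi * β) * η)
      (by nlinarith [mul_nonneg hA h]) (by nlinarith [mul_nonneg hB h])
    push_cast at this
    nlinarith
  · rw [norm_mul, norm_neg, hnorm]
    push Not at h
    have := key ((2 * Real.pi * α) * η) ((2 * Real.pi * β) * η)
      (by nlinarith [mul_nonneg hA (neg_nonneg.2 h.le)])
      (by nlinarith [mul_nonneg hB (neg_nonneg.2 h.le)])
    push_cast at this
    nlinarith

theorem integrable_truncSymb {α β : ℝ} (hα : 0 < α) (hβ : 0 < β) :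
    Integrable (truncSymb α β) := by
  have hpi := Real.pi_pos
  rw [← integrableOn_univ, ← Set.Iic_union_Ioi (a := (0 : ℝ))]
  refine IntegrableOn.union ?_ ?_
  · have : IntegrableOn (fun η : ℝ => -(Real.pi * I) *
        (cexp ((2 * Real.pi * α : ℂ) * η) - cexp ((2 * Real.pi * β : ℂ) * η))) (Set.Iic 0) := by
      refine Integrable.const_mul (Integrable.sub ?_ ?_) _
      · exact integrableOn_exp_mul_complex_Iic (by simpa using by positivity) 0
      · exact integrableOn_exp_mul_complex_Iic (by simpa using by positivity) 0
    refine this.congr_fun (fun η hη => ?_) measurableSet_Iic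
    simp only [truncSymb]
    split_ifs with h
    · have : η = 0 := le_antisymm hη h
      subst this; simp
    · rfl
  · have : IntegrableOn (fun η : ℝ => (Real.pi * I) *
        (cexp ((-(2 * Real.pi * α) : ℂ) * η) - cexp ((-(2 * Real.pi * β) : ℂ) * η)))
        (Set.Ioi 0) := by
      refine Integrable.const_mul (Integrable.sub ?_ ?_) _
      · exact integrableOn_exp_mul_complex_Ioi (by simpa using by positivity) 0
      · exact integrableOn_exp_mul_complex_Ioi (by simpa using by positivity) 0
    refine this.congr_fun (fun η hη => ?_) measurableSet_Ioi
    simp only [truncSymb]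
    rw [if_pos (le_of_lt hη)]

theorem FT1_truncSymb {α β : ℝ} (hα : 0 < α) (hβ : 0 < β) :
    FT1 (truncSymb α β) = truncKer α β := by
  have hpi := Real.pi_pos
  funext s
  have hprod : Integrable fun η => truncSymb α β η * e2pi (-(η * s)) :=
    (integrable_truncSymb hα hβ).mul_bdd (c := 1)
      (by fun_prop : Continuous fun η => e2pi (-(η * s))).aestronglyMeasurable
      (Filter.Eventually.of_forall fun w => (norm_e2pi _).le)
  have hre : ∀ {a : ℝ}, 0 < a → 0 < (2 * Real.pi * a - 2 * Real.pi * s * I : ℂ).re := by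
    intro a ha; simpa using by positivity
  have hre' : ∀ {a : ℝ}, 0 < a → (-(2 * Real.pi * a + 2 * Real.pi * s * I) : ℂ).re < 0 := by
    intro a ha
    have : 0 < 2 * Real.pi * a := by positivity
    simpa using this
  rw [FT1, ← intervalIntegral.integral_Iic_add_Ioi (b := (0 : ℝ)) hprod.integrableOn
    hprod.integrableOn]
  have e1 : ∫ η in Set.Iic (0 : ℝ), truncSymb α β η * e2pi (-(η * s)) =
      -(Real.pi * I) * (1 / (2 * Real.pi * α - 2 * Real.pi * s * I) -
        1 / (2 * Real.pi * β - 2 * Real.pi * s * I)) := by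
    have h1 := integral_exp_mul_complex_Iic (hre hα) 0
    have h2 := integral_exp_mul_complex_Iic (hre hβ) 0
    simp only [Complex.ofReal_zero, mul_zero, Complex.exp_zero] at h1 h2
    rw [← h1, ← h2, ← integral_sub (integrableOn_exp_mul_complex_Iic (hre hα) 0)
      (integrableOn_exp_mul_complex_Iic (hre hβ) 0), ← integral_const_mul]
    refine setIntegral_congr_fun measurableSet_Iic fun η hη => ?_
    have : truncSymb α β η = -(Real.pi * I) *
        (cexp ((2 * Real.pi * α) * η) - cexp ((2 * Real.pi * β) * η)) := by
      simp only [truncSymb]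
      split_ifs with h
      · have : η = 0 := le_antisymm hη h
        subst this; simp
      · rfl
    simp only [this, e2pi]
    rw [mul_assoc, sub_mul, ← Complex.exp_add, ← Complex.exp_add]
    congr 3 <;> · push_cast; ring
  have e2 : ∫ η in Set.Ioi (0 : ℝ), truncSymb α β η * e2pi (-(η * s)) =
      (Real.pi * I) * (1 / (2 * Real.pi * α + 2 * Real.pi * s * I) -
        1 / (2 * Real.pi * β + 2 * Real.pi * s * I)) := by
    have h1 := integral_exp_mul_complex_Ioi (hre' hα) 0
    have h2 := integral_exp_mul_complex_Ioi (hre' hβ) 0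
    simp only [Complex.ofReal_zero, mul_zero, Complex.exp_zero, neg_div_neg_eq] at h1 h2
    rw [← h1, ← h2, ← integral_sub (integrableOn_exp_mul_complex_Ioi (hre' hα) 0)
      (integrableOn_exp_mul_complex_Ioi (hre' hβ) 0), ← integral_const_mul]
    refine setIntegral_congr_fun measurableSet_Ioi fun η hη => ?_
    simp only [truncSymb, e2pi]
    rw [if_pos (le_of_lt hη), mul_assoc, sub_mul, ← Complex.exp_add, ← Complex.exp_add]
    congr 3 <;> · push_cast; ring
  rw [e1, e2]
  have hne : ∀ {z : ℂ}, z.re ≠ 0 → z ≠ 0 := by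
    intro z hz h; rw [h] at hz; simp at hz
  have key : ∀ {a : ℝ}, 0 < a →
      (Real.pi * I) * (1 / (2 * Real.pi * a + 2 * Real.pi * s * I)) -
        (Real.pi * I) * (1 / (2 * Real.pi * a - 2 * Real.pi * s * I)) =
      ((s / (s ^ 2 + a ^ 2) : ℝ) : ℂ) := by
    intro a ha
    have d1 := hne (hre ha).ne'
    have d2 := hne (hre' ha).ne
    rw [neg_ne_zero] at d2
    have d3 : ((s ^ 2 + a ^ 2 : ℝ) : ℂ) ≠ 0 := by
      have : s ^ 2 + a ^ 2 ≠ 0 := by positivity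
      exact_mod_cast this
    have hpc : (Real.pi : ℂ) ≠ 0 := by exact_mod_cast hpi.ne'
    push_cast at d3 ⊢
    have hd1 : (a - I * s : ℂ) ≠ 0 := by
      intro h; apply d1; linear_combination (2 * Real.pi : ℂ) * h
    have hd2 : (a + I * s : ℂ) ≠ 0 := by
      intro h; apply d2; linear_combination (2 * Real.pi : ℂ) * h
    rw [show (2 * Real.pi * a + 2 * Real.pi * s * I : ℂ) = 2 * Real.pi * (a + I * s) by ring,
      show (2 * Real.pi * a - 2 * Real.pi * s * I : ℂ) = 2 * Real.pi * (a - I * s) by ring]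
    field_simp
    linear_combination (-2 * s * a ^ 2 : ℂ) * I_sq
  simp only [truncKer, Complex.ofReal_sub]
  rw [← key hα, ← key hβ]
  ring

theorem continuous_truncKer {α β : ℝ} (hα : 0 < α) (hβ : 0 < β) :
    Continuous (truncKer α β) := by
  unfold truncKer
  have h : ∀ {a : ℝ}, 0 < a → Continuous fun s : ℝ => s / (s ^ 2 + a ^ 2) := fun ha =>
    continuous_id.div (by fun_prop) fun s => by positivity
  exact Complex.continuous_ofReal.comp ((h hα).sub (h hβ))

theorem norm_mul_truncKer_le {α β : ℝ} (hα : 0 < α) (hβ : 0 < β) (s : ℝ) :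
    ‖(s : ℂ) * truncKer α β s‖ ≤ 1 := by
  have h : ∀ {a : ℝ}, 0 < a → 0 ≤ s ^ 2 / (s ^ 2 + a ^ 2) ∧ s ^ 2 / (s ^ 2 + a ^ 2) ≤ 1 := by
    intro a ha
    refine ⟨by positivity, ?_⟩
    rw [div_le_one (by positivity)]
    nlinarith
  rw [truncKer, ← Complex.ofReal_mul, Complex.norm_real, Real.norm_eq_abs, mul_sub,
    mul_div_assoc', mul_div_assoc', ← sq, abs_le]
  have h1 := h hα
  have h2 := h hβ
  constructor <;> linarith

theorem integrable_truncKer {α β : ℝ} (hα : 0 < α) (hβ : 0 < β) :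
    Integrable (truncKer α β) := by
  have hbound : ∀ s, ‖truncKer α β s‖ ≤ (|β ^ 2 - α ^ 2| * (1 / (2 * α)) * (1 + 1 / β ^ 2)) *
      (1 + s ^ 2)⁻¹ := by
    intro s
    have e : s / (s ^ 2 + α ^ 2) - s / (s ^ 2 + β ^ 2) =
        (β ^ 2 - α ^ 2) * (s / (s ^ 2 + α ^ 2)) * (1 / (s ^ 2 + β ^ 2)) := by
      field_simp
      ring
    rw [truncKer, Complex.norm_real, Real.norm_eq_abs, e, abs_mul, abs_mul,
      mul_assoc _ (1 + 1 / β ^ 2)]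
    gcongr
    · rw [abs_div, abs_of_pos (by positivity : 0 < s ^ 2 + α ^ 2), div_le_div_iff₀ (by positivity)
        (by positivity)]
      nlinarith [sq_nonneg (|s| - α), sq_abs s]
    · rw [abs_of_pos (by positivity), ← div_eq_mul_inv, div_le_div_iff₀ (by positivity)
        (by positivity)]
      have : (1 + 1 / β ^ 2) * (s ^ 2 + β ^ 2) = s ^ 2 + β ^ 2 + s ^ 2 / β ^ 2 + 1 := by
        field_simp
        ring
      rw [this]
      have : 0 ≤ s ^ 2 / β ^ 2 := by positivity
      nlinarith [sq_nonneg β]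
  exact ((integrable_inv_one_add_sq.const_mul _).mono'
    (continuous_truncKer hα hβ).aestronglyMeasurable (Filter.Eventually.of_forall hbound))

theorem isInvFT_truncSymb {α β : ℝ} (hα : 0 < α) (hβ : 0 < β) :
    IsInvFT (truncKer α β) (truncSymb α β) := by
  rw [← FT1_truncSymb hα hβ]
  refine isInvFT_of_integrable (continuous_truncSymb α β) (integrable_truncSymb hα hβ) ?_
  rw [FT1_truncSymb hα hβ]
  exact integrable_truncKer hα hβ

theorem tendsto_truncSymb (η : ℝ) :
    Filter.Tendsto (fun n : ℕ => truncSymb (1 / ((n : ℝ) + 1)) ((n : ℝ) + 1) η) Filter.atTop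
      (nhds (Real.pi * I * (Real.sign η : ℝ))) := by
  have hpi := Real.pi_pos
  have h0 : Filter.Tendsto (fun n : ℕ => 1 / ((n : ℝ) + 1)) Filter.atTop (nhds 0) :=
    tendsto_one_div_add_atTop_nhds_zero_nat
  have hi : Filter.Tendsto (fun n : ℕ => (n : ℝ) + 1) Filter.atTop Filter.atTop :=
    Filter.tendsto_atTop_add_const_right _ _ tendsto_natCast_atTop_atTop
  have key : ∀ {x : ℝ}, 0 < x → Filter.Tendsto (fun n : ℕ =>
      (Real.exp (-(2 * Real.pi * (1 / ((n : ℝ) + 1)) * x)) -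
        Real.exp (-(2 * Real.pi * ((n : ℝ) + 1) * x)) : ℝ)) Filter.atTop (nhds 1) := by
    intro x hx
    have h1 : Filter.Tendsto (fun n : ℕ => Real.exp (-(2 * Real.pi * (1 / ((n : ℝ) + 1)) * x)))
        Filter.atTop (nhds 1) := by
      have := (Real.continuous_exp.tendsto 0).comp
        (((h0.const_mul (2 * Real.pi)).mul_const x).neg.trans (by simp))
      simpa [Function.comp_def] using this
    have h2 : Filter.Tendsto (fun n : ℕ => Real.exp (-(2 * Real.pi * ((n : ℝ) + 1) * x)))
        Filter.atTop (nhds 0) :=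
      Real.tendsto_exp_neg_atTop_nhds_zero.comp
        ((hi.const_mul_atTop (by positivity)).atTop_mul_const hx)
    simpa using h1.sub h2
  rcases lt_trichotomy η 0 with h | h | h
  · have hk := ((Complex.continuous_ofReal.tendsto _).comp (key (neg_pos.2 h))).const_mul
      (-(Real.pi * I) : ℂ)
    rw [Real.sign_of_neg h]
    refine (hk.congr fun n => ?_).trans (by simp)
    simp only [truncSymb, Function.comp, if_neg (not_le.2 h)]
    push_cast
    congr 3 <;> ring
  · subst h
    simp [truncSymb]
  · have hk := ((Complex.continuous_ofReal.tendsto _).comp (key h)).const_mul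
      (Real.pi * I : ℂ)
    rw [Real.sign_of_pos h]
    refine (hk.congr fun n => ?_).trans (by simp)
    simp only [truncSymb, Function.comp, if_pos h.le]
    push_cast
    congr 3 <;> ring

theorem norm_integral_ker_mul_le {k m a A : ℝ → ℂ} (hk : IsInvFT k m) {M : ℝ}
    (hM : ∀ η, ‖m η‖ ≤ M) (hA : IsInvFT a A) (s₀ η : ℝ) :
    ‖∫ s, k s * A (s - s₀) * e2pi (s * η)‖ ≤ M * ∫ ξ, ‖a ξ‖ := by
  have hΘ : Integrable fun s => k s * e2pi (s * η) :=
    hk.integrable.mul_bdd (c := 1) (by fun_prop : Continuous fun s => e2pi (s * η)).aestronglyMeasurable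
      (Filter.Eventually.of_forall fun w => (norm_e2pi _).le)
  have h := integral_mul_superposition hΘ hA.integrable (measurable_id.sub_const s₀)
  have e : ∫ s, k s * A (s - s₀) * e2pi (s * η) =
      ∫ ξ, a ξ * (e2pi (-(s₀ * ξ)) * m (η + ξ)) := by
    calc _ = ∫ s, k s * e2pi (s * η) * ∫ ξ, a ξ * e2pi ((s - s₀) * ξ) := by
          refine integral_congr_ae (Filter.Eventually.of_forall fun s => ?_)
          dsimp only
          rw [← hA.eq_integral]; ring
      _ = _ := by
          refine h.trans (integral_congr_ae (Filter.Eventually.of_forall fun ξ => ?_))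
          dsimp only
          rw [hk.eq_integral, ← integral_const_mul (e2pi _)]
          refine congrArg (a ξ * ·) ?_
          refine integral_congr_ae (Filter.Eventually.of_forall fun s => ?_)
          simp only [id]
          rw [mul_assoc, ← e2pi_add, mul_left_comm, ← e2pi_add]
          congr 2
          ring
  rw [e, ← integral_const_mul]
  refine norm_integral_le_of_norm_le (hA.integrable.norm.const_mul M)
    (Filter.Eventually.of_forall fun ξ => ?_)
  rw [norm_mul, norm_mul, norm_e2pi, one_mul, mul_comm]
  exact mul_le_mul_of_nonneg_right (hM _) (norm_nonneg _)

theorem integrable_mul_gaus {b : ℝ} (hb : 0 < b) : Integrable fun x : ℝ => (x : ℂ) * gaus b x := by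
  refine (integrable_mul_exp_neg_mul_sq hb).ofReal.congr (Filter.Eventually.of_forall fun x => ?_)
  simp [gaus]

theorem hasDerivAt_gaus (b x : ℝ) : HasDerivAt (gaus b) (-(2 * b * x) * gaus b x) x := by
  have h : HasDerivAt (fun x : ℝ => -b * x ^ 2) (-b * (2 * x)) x := by
    simpa using (hasDerivAt_pow 2 x).const_mul (-b)
  have := h.exp.ofReal_comp
  refine this.congr_deriv ?_
  simp only [gaus]
  push_cast
  ring

theorem isInvFT_mul_gaus {b : ℝ} (hb : 0 < b) :
    IsInvFT (FT1 fun x : ℝ => (x : ℂ) * gaus b x) fun x : ℝ => (x : ℂ) * gaus b x := by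
  have hpi := Real.pi_pos
  refine isInvFT_of_integrable (by fun_prop) (integrable_mul_gaus hb) ?_
  have h := Real.hasDerivAt_fourier (integrable_gaus hb)
    ((integrable_mul_gaus hb).congr (Filter.Eventually.of_forall fun x => by simp))
  rw [← FT1_eq_fourier, ← FT1_eq_fourier, FT1_gaus hb] at h
  have e : (FT1 fun x : ℝ => (x : ℂ) * gaus b x) = fun ξ : ℝ =>
      (-2 * Real.pi * I)⁻¹ * ((√(Real.pi / b) : ℝ) * (-(2 * (Real.pi ^ 2 / b : ℝ) : ℂ))) *
        (ξ * gaus (Real.pi ^ 2 / b) ξ) := by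
    funext ξ
    have h1 := (h ξ).unique ((hasDerivAt_gaus (Real.pi ^ 2 / b) ξ).const_mul
      ((√(Real.pi / b) : ℝ) : ℂ))
    have h2 : FT1 (fun x : ℝ => (-2 * Real.pi * I * x : ℂ) • gaus b x) ξ =
        (-2 * Real.pi * I) * FT1 (fun x : ℝ => (x : ℂ) * gaus b x) ξ := by
      simp only [FT1]
      rw [← integral_const_mul]
      refine integral_congr_ae (Filter.Eventually.of_forall fun x => ?_)
      simp only [smul_eq_mul]
      ring
    have h3 : (-2 * Real.pi * I : ℂ) ≠ 0 := by
      have : (Real.pi : ℂ) ≠ 0 := by exact_mod_cast hpi.ne'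
      simp [this]
    rw [h2] at h1
    rw [mul_assoc _ (_ * _), eq_inv_mul_iff_mul_eq₀ h3, h1]
    ring
  rw [e]
  exact (integrable_mul_gaus (by positivity)).const_mul _

/-- Uniform decay of the windowed truncated kernels. -/
theorem exists_norm_integral_truncKer_le : ∃ C : ℝ, 0 < C ∧ ∀ α β : ℝ, 0 < α → 0 < β →
    ∀ s₀ η : ℝ, ‖∫ s, truncKer α β s * gaus 1 (s - s₀) * e2pi (s * η)‖ ≤ C / (1 + |s₀|) := by
  have hpi := Real.pi_pos
  set A₀ := ∫ ξ, ‖FT1 (gaus 1) ξ‖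
  set A₁ := ∫ ξ, ‖FT1 (fun x : ℝ => (x : ℂ) * gaus 1 x) ξ‖
  set A₂ := ∫ s, ‖gaus 1 s‖
  have n0 : 0 ≤ A₀ := integral_nonneg fun _ => norm_nonneg _
  have n1 : 0 ≤ A₁ := integral_nonneg fun _ => norm_nonneg _
  have n2 : 0 ≤ A₂ := integral_nonneg fun _ => norm_nonneg _
  refine ⟨Real.pi * A₀ + Real.pi * A₁ + A₂ + 1, by positivity, fun α β hα hβ s₀ η => ?_⟩
  have hk := isInvFT_truncSymb hα hβ
  have hm := norm_truncSymb_le hα hβ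
  have b0 := norm_integral_ker_mul_le hk hm (isInvFT_gaus one_pos) s₀ η
  have b1 := norm_integral_ker_mul_le hk hm (isInvFT_mul_gaus one_pos) s₀ η
  have hg := (integrable_gaus one_pos).comp_sub_right s₀
  have b2 : ‖∫ s : ℝ, (s * truncKer α β s) * gaus 1 (s - s₀) * e2pi (s * η)‖ ≤ A₂ := by
    refine (norm_integral_le_of_norm_le hg.norm
      (Filter.Eventually.of_forall fun s => ?_)).trans (le_of_eq ?_)
    · rw [norm_mul, norm_mul, norm_e2pi, mul_one]
      exact mul_le_of_le_one_left (norm_nonneg _) (norm_mul_truncKer_le hα hβ s)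
    · exact integral_sub_right_eq_self (fun s => ‖gaus 1 s‖) s₀
  set J := ∫ s, truncKer α β s * gaus 1 (s - s₀) * e2pi (s * η) with hJ
  have he : Continuous fun s => e2pi (s * η) := by fun_prop
  have hK := continuous_truncKer hα hβ
  have eJ : (s₀ : ℂ) * J = (∫ s : ℝ, (s * truncKer α β s) * gaus 1 (s - s₀) * e2pi (s * η)) -
      ∫ s : ℝ, truncKer α β s * (((s - s₀ : ℝ) : ℂ) * gaus 1 (s - s₀)) * e2pi (s * η) := by
    rw [hJ, ← integral_const_mul, ← integral_sub]
    · refine integral_congr_ae (Filter.Eventually.of_forall fun s => ?_)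
      push_cast
      ring
    · refine (hg.bdd_mul (c := 1) ?_ ?_).mul_bdd (c := 1) he.aestronglyMeasurable ?_
      · exact (Complex.continuous_ofReal.mul hK).aestronglyMeasurable
      · exact Filter.Eventually.of_forall fun s => norm_mul_truncKer_le hα hβ s
      · exact Filter.Eventually.of_forall fun s => (norm_e2pi _).le
    · refine (hk.integrable.mul_bdd (c := A₁) ?_ ?_).mul_bdd (c := 1) he.aestronglyMeasurable ?_
      · exact (by fun_prop : Continuous fun s : ℝ =>
          ((s - s₀ : ℝ) : ℂ) * gaus 1 (s - s₀)).aestronglyMeasurable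
      · exact Filter.Eventually.of_forall fun s => (isInvFT_mul_gaus one_pos).norm_le (s - s₀)
      · exact Filter.Eventually.of_forall fun s => (norm_e2pi _).le
  have b3 : |s₀| * ‖J‖ ≤ A₂ + Real.pi * A₁ := by
    have : |s₀| * ‖J‖ = ‖(s₀ : ℂ) * J‖ := by rw [norm_mul, Complex.norm_real, Real.norm_eq_abs]
    rw [this, eJ]
    exact (norm_sub_le _ _).trans (add_le_add b2 b1)
  rw [le_div_iff₀ (by positivity)]
  nlinarith

theorem enorm_integral_superposition_le {Z : Type*} [MeasurableSpace Z] {μ : Measure Z} [SFinite μ]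
    {Θ : Z → ℂ} (hΘ : Integrable Θ μ) {a A : ℝ → ℂ} (hA : IsInvFT a A) {E : Z → ℝ}
    (hE : Measurable E) :
    ‖∫ z, Θ z * A (E z) ∂μ‖ₑ ≤ ∫⁻ ν, ‖a ν‖ₑ * ‖∫ z, Θ z * e2pi (E z * ν) ∂μ‖ₑ := by
  simp_rw [hA.eq_integral]
  rw [integral_mul_superposition hΘ hA.integrable hE]
  refine (enorm_integral_le_lintegral_enorm _).trans (le_of_eq ?_)
  simp_rw [enorm_mul]

theorem enorm_integral_superposition₃_le {Z : Type*} [MeasurableSpace Z] {μ : Measure Z}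
    [SFinite μ] {Θ : Z → ℂ} (hΘ : Integrable Θ μ) {a A b B c C : ℝ → ℂ} (hA : IsInvFT a A)
    (hB : IsInvFT b B) (hC : IsInvFT c C) {E₁ E₂ E₃ : Z → ℝ}
    (h₁ : Measurable E₁) (h₂ : Measurable E₂) (h₃ : Measurable E₃) :
    ‖∫ z, Θ z * A (E₁ z) * B (E₂ z) * C (E₃ z) ∂μ‖ₑ ≤
      ∫⁻ ν₃, ‖c ν₃‖ₑ * ∫⁻ ν₂, ‖b ν₂‖ₑ * ∫⁻ ν₁, ‖a ν₁‖ₑ *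
        ‖∫ z, Θ z * e2pi (E₃ z * ν₃) * e2pi (E₂ z * ν₂) * e2pi (E₁ z * ν₁) ∂μ‖ₑ := by
  have bdd : ∀ {Ψ : Z → ℂ} (_ : Integrable Ψ μ) {d D : ℝ → ℂ} (_ : IsInvFT d D) {E : Z → ℝ}
      (_ : Measurable E), Integrable (fun z => Ψ z * D (E z)) μ := fun hΨ _ _ hD _ hE =>
    hΨ.mul_bdd (hD.continuous.measurable.comp hE).aestronglyMeasurable
      (Filter.Eventually.of_forall fun z => hD.norm_le _)
  have bde : ∀ {Ψ : Z → ℂ} (_ : Integrable Ψ μ) {E : Z → ℝ} (_ : Measurable E) (ν : ℝ),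
      Integrable (fun z => Ψ z * e2pi (E z * ν)) μ := fun hΨ _ hE ν =>
    hΨ.mul_bdd (c := 1) (continuous_e2pi.measurable.comp (hE.mul_const ν)).aestronglyMeasurable
      (Filter.Eventually.of_forall fun z => (norm_e2pi _).le)
  refine (enorm_integral_superposition_le (bdd (bdd hΘ hA h₁) hB h₂) hC h₃).trans ?_
  gcongr with ν₃
  have e2 : ∫ z, Θ z * A (E₁ z) * B (E₂ z) * e2pi (E₃ z * ν₃) ∂μ =
      ∫ z, Θ z * e2pi (E₃ z * ν₃) * A (E₁ z) * B (E₂ z) ∂μ := by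
    congr 1; funext z; ring
  rw [e2]
  refine (enorm_integral_superposition_le (bdd (bde hΘ h₃ ν₃) hA h₁) hB h₂).trans ?_
  gcongr with ν₂
  have e1 : ∫ z, Θ z * e2pi (E₃ z * ν₃) * A (E₁ z) * e2pi (E₂ z * ν₂) ∂μ =
      ∫ z, Θ z * e2pi (E₃ z * ν₃) * e2pi (E₂ z * ν₂) * A (E₁ z) ∂μ := by
    congr 1; funext z; ring
  rw [e1]
  exact enorm_integral_superposition_le (bde (bde hΘ h₃ ν₃) h₂ ν₂) hA h₁

theorem integrable_shear {Z : Type*} [MeasurableSpace Z] {μ : Measure Z} [SFinite μ]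
    {K : Z → ℂ} (hK : Integrable K μ) {G : ℝ → ℂ} (hG : Integrable G) (hGm : Measurable G)
    {φ : Z → ℝ} (hφ : Measurable φ) :
    Integrable (fun w : Z × ℝ => K w.1 * G (w.2 + φ w.1)) (μ.prod volume) := by
  have hm : AEStronglyMeasurable (fun w : Z × ℝ => K w.1 * G (w.2 + φ w.1)) (μ.prod volume) :=
    hK.aestronglyMeasurable.comp_fst.mul (hGm.comp
      (measurable_snd.add (hφ.comp measurable_fst))).aestronglyMeasurable
  rw [integrable_prod_iff hm]
  refine ⟨Filter.Eventually.of_forall fun z => (hG.comp_add_right (φ z)).const_mul (K z), ?_⟩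
  simp_rw [norm_mul, integral_const_mul]
  refine (hK.norm.mul_const (∫ x, ‖G x‖)).congr (Filter.Eventually.of_forall fun z => ?_)
  dsimp only
  rw [integral_add_right_eq_self (fun x => ‖G x‖)]

/-- Trilinear Fourier multiplier with symbol `σ(ξ₁ - ξ₂ - 2ξ₃)`. -/
def trilMul (σ : ℝ → ℂ) (f g h : ℝ → ℂ) (x : ℝ) : ℂ :=
  ∫ ξ : ℝ × ℝ × ℝ, σ (ξ.1 - ξ.2.1 - 2 * ξ.2.2) *
    FT1 f ξ.1 * FT1 g ξ.2.1 * FT1 h ξ.2.2 * e2pi (x * (ξ.1 + ξ.2.1 + ξ.2.2))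

theorem TH_eq_trilMul (f g h : ℝ → ℂ) :
    TH f g h = trilMul (fun η => (Real.pi : ℂ) * I * (Real.sign η : ℝ)) f g h := rfl

theorem measurable_sign_symb : Measurable fun η => (Real.pi : ℂ) * I * (Real.sign η : ℝ) := by
  have : Measurable Real.sign := by
    unfold Real.sign
    exact Measurable.ite measurableSet_Iio measurable_const
      (Measurable.ite measurableSet_Ioi measurable_const measurable_const)
  fun_prop

theorem norm_sign_symb_le (η : ℝ) : ‖(Real.pi : ℂ) * I * (Real.sign η : ℝ)‖ ≤ Real.pi := by
  have hpi := Real.pi_pos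
  rcases Real.sign_apply_eq η with h | h | h <;> simp [h, abs_of_pos hpi, hpi.le]

theorem continuous_FT1 (f : SchwartzMap ℝ ℂ) : Continuous (FT1 f) := by
  rw [FT1_eq_fourier, ← SchwartzMap.fourier_coe]
  exact SchwartzMap.continuous _

theorem integrable_FT1_prod (f g h : SchwartzMap ℝ ℂ) :
    Integrable fun ξ : ℝ × ℝ × ℝ => FT1 f ξ.1 * (FT1 g ξ.2.1 * FT1 h ξ.2.2) :=
  (isInvFT_schwartz f).integrable.mul_prod
    ((isInvFT_schwartz g).integrable.mul_prod (isInvFT_schwartz h).integrable)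

theorem norm_trilMul_integrand_le {σ : ℝ → ℂ} {M : ℝ} (hM : ∀ η, ‖σ η‖ ≤ M)
    (f g h : ℝ → ℂ) (x : ℝ) (ξ : ℝ × ℝ × ℝ) :
    ‖σ (ξ.1 - ξ.2.1 - 2 * ξ.2.2) * FT1 f ξ.1 * FT1 g ξ.2.1 * FT1 h ξ.2.2 *
      e2pi (x * (ξ.1 + ξ.2.1 + ξ.2.2))‖ ≤ M * ‖FT1 f ξ.1 * (FT1 g ξ.2.1 * FT1 h ξ.2.2)‖ := by
  rw [norm_mul, norm_e2pi, mul_one, mul_assoc, mul_assoc, norm_mul]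
  exact mul_le_mul_of_nonneg_right (hM _) (norm_nonneg _)

theorem norm_trilMul_le {σ : ℝ → ℂ} {M : ℝ} (hM : ∀ η, ‖σ η‖ ≤ M)
    (f g h : SchwartzMap ℝ ℂ) (x : ℝ) :
    ‖trilMul σ f g h x‖ ≤
      M * ∫ ξ : ℝ × ℝ × ℝ, ‖FT1 f ξ.1 * (FT1 g ξ.2.1 * FT1 h ξ.2.2)‖ := by
  rw [← integral_const_mul]
  exact norm_integral_le_of_norm_le ((integrable_FT1_prod f g h).norm.const_mul M)
    (Filter.Eventually.of_forall fun ξ => norm_trilMul_integrand_le hM f g h x ξ)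

theorem measurable_trilMul_integrand {σ : ℝ → ℂ} (hσ : Measurable σ) (f g h : SchwartzMap ℝ ℂ) :
    Measurable (Function.uncurry fun (x : ℝ) (ξ : ℝ × ℝ × ℝ) => σ (ξ.1 - ξ.2.1 - 2 * ξ.2.2) *
      FT1 f ξ.1 * FT1 g ξ.2.1 * FT1 h ξ.2.2 * e2pi (x * (ξ.1 + ξ.2.1 + ξ.2.2))) := by
  have hf := (continuous_FT1 f).measurable
  have hg := (continuous_FT1 g).measurable
  have hh := (continuous_FT1 h).measurable
  have he := continuous_e2pi.measurable
  unfold Function.uncurry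
  fun_prop

theorem measurable_trilMul {σ : ℝ → ℂ} (hσ : Measurable σ) (f g h : SchwartzMap ℝ ℂ) :
    Measurable (trilMul σ f g h) :=
  ((measurable_trilMul_integrand hσ f g h).stronglyMeasurable.integral_prod_right).measurable

theorem tendsto_trilMul {σ : ℕ → ℝ → ℂ} (hσ : ∀ n, Measurable (σ n)) {τ : ℝ → ℂ} {M : ℝ}
    (hM : ∀ n η, ‖σ n η‖ ≤ M)
    (hlim : ∀ η, Filter.Tendsto (fun n => σ n η) Filter.atTop (nhds (τ η)))
    (f g h : SchwartzMap ℝ ℂ) (x : ℝ) :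
    Filter.Tendsto (fun n => trilMul (σ n) f g h x) Filter.atTop (nhds (trilMul τ f g h x)) := by
  refine tendsto_integral_of_dominated_convergence _ (fun n => ?_)
    ((integrable_FT1_prod f g h).norm.const_mul M)
    (fun n => Filter.Eventually.of_forall fun ξ => norm_trilMul_integrand_le (hM n) f g h x ξ)
    (Filter.Eventually.of_forall fun ξ => ?_)
  · exact ((measurable_trilMul_integrand (hσ n) f g h).comp
      (measurable_const.prodMk measurable_id : Measurable fun ξ => (x, ξ))).aestronglyMeasurable
  · exact ((((hlim _).mul_const _).mul_const _).mul_const _).mul_const _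

theorem tendsto_STFT {F : ℕ → ℝ → ℂ} (hF : ∀ n, Measurable (F n)) {G : ℝ → ℂ} {M : ℝ}
    (hM : ∀ n x, ‖F n x‖ ≤ M)
    (hlim : ∀ x, Filter.Tendsto (fun n => F n x) Filter.atTop (nhds (G x)))
    {b : ℝ} (hb : 0 < b) (t ν : ℝ) :
    Filter.Tendsto (fun n => STFT1 (gaus b) (F n) t ν) Filter.atTop
      (nhds (STFT1 (gaus b) G t ν)) := by
  refine tendsto_integral_of_dominated_convergence _ (fun n => ?_)
    (((integrable_gaus hb).comp_sub_right t).norm.const_mul M)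
    (fun n => Filter.Eventually.of_forall fun y => ?_)
    (Filter.Eventually.of_forall fun y => ?_)
  · have := hF n
    have he := continuous_e2pi.measurable
    have hg := (continuous_gaus b).measurable
    exact (by fun_prop : Measurable fun y => F n y * e2pi (-(y * ν)) *
      gaus b (y - t)).aestronglyMeasurable
  · rw [norm_mul, norm_mul, norm_e2pi, mul_one]
    exact mul_le_mul_of_nonneg_right (hM n y) (norm_nonneg _)
  · exact ((hlim y).mul_const _).mul_const _

theorem trilMul_eq_integral {k m : ℝ → ℂ} (hk : IsInvFT k m) (f g h : SchwartzMap ℝ ℂ) (x : ℝ) :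
    trilMul m f g h x = ∫ s, k s * (f (x + s) * g (x - s) * h (x - 2 * s)) := by
  have hΘ : Integrable fun ξ : ℝ × ℝ × ℝ =>
      FT1 f ξ.1 * (FT1 g ξ.2.1 * FT1 h ξ.2.2) * e2pi (x * (ξ.1 + ξ.2.1 + ξ.2.2)) :=
    (integrable_FT1_prod f g h).mul_bdd (c := 1)
      (by fun_prop : Continuous fun ξ : ℝ × ℝ × ℝ =>
        e2pi (x * (ξ.1 + ξ.2.1 + ξ.2.2))).aestronglyMeasurable
      (Filter.Eventually.of_forall fun w => (norm_e2pi _).le)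
  have hS := integral_mul_superposition hΘ hk.integrable
    (E := fun ξ : ℝ × ℝ × ℝ => ξ.1 - ξ.2.1 - 2 * ξ.2.2) (by fun_prop)
  refine (Eq.trans ?_ hS).trans ?_
  · refine integral_congr_ae (Filter.Eventually.of_forall fun ξ => ?_)
    dsimp only
    rw [← hk.eq_integral]
    ring
  · refine integral_congr_ae (Filter.Eventually.of_forall fun s => ?_)
    refine congrArg (k s * ·) ?_
    rw [(isInvFT_schwartz f).eq_integral, (isInvFT_schwartz g).eq_integral,
      (isInvFT_schwartz h).eq_integral, mul_assoc, ← integral_prod_mul, ← integral_prod_mul]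
    refine integral_congr_ae (Filter.Eventually.of_forall fun ξ => ?_)
    dsimp only
    have : e2pi (x * (ξ.1 + ξ.2.1 + ξ.2.2)) * e2pi ((ξ.1 - ξ.2.1 - 2 * ξ.2.2) * s) =
        e2pi ((x + s) * ξ.1) * e2pi ((x - s) * ξ.2.1) * e2pi ((x - 2 * s) * ξ.2.2) := by
      rw [← e2pi_add, ← e2pi_add, ← e2pi_add]
      congr 1
      ring
    rw [mul_assoc, this]
    ring

/-- The frequency profile of the Gaussian remainder window. -/
def freqDecay (ω : ℝ) : ℝ≥0∞ := ‖∫ x, gaus (5 / 2) x * e2pi (x * ω)‖ₑ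

/-- The localized pieces of the truncated trilinear transform. -/
def locPiece (k : ℝ → ℂ) (f g h : ℝ → ℂ) (y ν s₀ : ℝ) : ℂ :=
  ∫ w : ℝ × ℝ, k w.1 * gaus 5 (w.2 - y) * (f (w.2 + w.1) * g (w.2 - w.1) * h (w.2 - 2 * w.1)) *
    e2pi (-(w.2 * ν)) * gaus 9 (s₀ - w.1)

theorem enorm_locPiece_le {k m : ℝ → ℂ} (hk : IsInvFT k m) {B : ℝ → ℝ}
    (hB : ∀ s₀ η : ℝ, ‖∫ s, k s * gaus 1 (s - s₀) * e2pi (s * η)‖ ≤ B s₀)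
    (f g h : SchwartzMap ℝ ℂ) (y ν s₀ : ℝ) :
    ‖locPiece k f g h y ν s₀‖ₑ ≤ ∫⁻ ν₃, ‖STFT1 (gaus 1) h (y - 2 * s₀) ν₃‖ₑ *
      ∫⁻ ν₂, ‖STFT1 (gaus 1) g (y - s₀) ν₂‖ₑ *
        ∫⁻ ν₁, ‖STFT1 (gaus (1 / 2)) f (y + s₀) ν₁‖ₑ *
          (ENNReal.ofReal (B s₀) * freqDecay (ν₁ + ν₂ + ν₃ - ν)) := by
  have hkg : Integrable fun s => k s * gaus 1 (s - s₀) :=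
    hk.integrable.mul_bdd (c := 1) (by fun_prop : Continuous fun s =>
      gaus 1 (s - s₀)).aestronglyMeasurable
      (Filter.Eventually.of_forall fun s => norm_gaus_le zero_le_one _)
  have hΘ : Integrable fun w : ℝ × ℝ => k w.1 * gaus 1 (w.1 - s₀) *
      gaus (5 / 2) (w.2 + (w.1 - (y + s₀))) * e2pi (-(w.2 * ν)) :=
    (integrable_shear hkg (integrable_gaus (by norm_num)) (continuous_gaus _).measurable
      (by fun_prop : Measurable fun s : ℝ => s - (y + s₀))).mul_bdd (c := 1)
      (by fun_prop : Continuous fun w : ℝ × ℝ => e2pi (-(w.2 * ν))).aestronglyMeasurable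
      (Filter.Eventually.of_forall fun w => (norm_e2pi _).le)
  have h0 := enorm_integral_superposition₃_le hΘ
    (isInvFT_STFT f (b := 1 / 2) (by norm_num) (y + s₀)) (isInvFT_STFT g one_pos (y - s₀))
    (isInvFT_STFT h one_pos (y - 2 * s₀)) (E₁ := fun w => w.2 + w.1) (E₂ := fun w => w.2 - w.1)
    (E₃ := fun w => w.2 - 2 * w.1) (by fun_prop) (by fun_prop) (by fun_prop)
  have e : locPiece k f g h y ν s₀ = ∫ w : ℝ × ℝ, k w.1 * gaus 1 (w.1 - s₀) *
      gaus (5 / 2) (w.2 + (w.1 - (y + s₀))) * e2pi (-(w.2 * ν)) *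
      (f (w.2 + w.1) * gaus (1 / 2) (w.2 + w.1 - (y + s₀))) *
      (g (w.2 - w.1) * gaus 1 (w.2 - w.1 - (y - s₀))) *
      (h (w.2 - 2 * w.1) * gaus 1 (w.2 - 2 * w.1 - (y - 2 * s₀))) := by
    refine integral_congr_ae (Filter.Eventually.of_forall fun w => ?_)
    have : gaus 5 (w.2 - y) * gaus 9 (s₀ - w.1) = gaus 1 (w.1 - s₀) *
        gaus (5 / 2) (w.2 + (w.1 - (y + s₀))) * gaus (1 / 2) (w.2 + w.1 - (y + s₀)) *
        gaus 1 (w.2 - w.1 - (y - s₀)) * gaus 1 (w.2 - 2 * w.1 - (y - 2 * s₀)) := by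
      simp only [gaus, ← Complex.ofReal_mul, ← Real.exp_add]
      congr 2
      ring
    linear_combination (k w.1 * (f (w.2 + w.1) * g (w.2 - w.1) * h (w.2 - 2 * w.1)) *
      e2pi (-(w.2 * ν))) * this
  rw [e]
  refine h0.trans ?_
  gcongr with ν₃ ν₂ ν₁
  have hprod : Integrable fun w : ℝ × ℝ => k w.1 * gaus 1 (w.1 - s₀) *
      gaus (5 / 2) (w.2 + (w.1 - (y + s₀))) * e2pi (-(w.2 * ν)) * e2pi ((w.2 - 2 * w.1) * ν₃) *
      e2pi ((w.2 - w.1) * ν₂) * e2pi ((w.2 + w.1) * ν₁) :=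
    ((hΘ.mul_bdd (c := 1) (by fun_prop : Continuous fun w : ℝ × ℝ =>
        e2pi ((w.2 - 2 * w.1) * ν₃)).aestronglyMeasurable
        (Filter.Eventually.of_forall fun w => (norm_e2pi _).le)).mul_bdd (c := 1)
      (by fun_prop : Continuous fun w : ℝ × ℝ => e2pi ((w.2 - w.1) * ν₂)).aestronglyMeasurable
      (Filter.Eventually.of_forall fun w => (norm_e2pi _).le)).mul_bdd (c := 1)
      (by fun_prop : Continuous fun w : ℝ × ℝ => e2pi ((w.2 + w.1) * ν₁)).aestronglyMeasurable
      (Filter.Eventually.of_forall fun w => (norm_e2pi _).le)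
  have e2 : ∫ w : ℝ × ℝ, k w.1 * gaus 1 (w.1 - s₀) *
      gaus (5 / 2) (w.2 + (w.1 - (y + s₀))) * e2pi (-(w.2 * ν)) * e2pi ((w.2 - 2 * w.1) * ν₃) *
      e2pi ((w.2 - w.1) * ν₂) * e2pi ((w.2 + w.1) * ν₁) =
      (∫ s, k s * gaus 1 (s - s₀) * e2pi (s * (ν - 2 * ν₂ - 3 * ν₃))) *
        (e2pi ((y + s₀) * (ν₁ + ν₂ + ν₃ - ν)) *
          ∫ x, gaus (5 / 2) x * e2pi (x * (ν₁ + ν₂ + ν₃ - ν))) := by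
    rw [Measure.volume_eq_prod, integral_prod _ hprod, ← integral_mul_const]
    refine integral_congr_ae (Filter.Eventually.of_forall fun s => ?_)
    dsimp only
    rw [← integral_add_right_eq_self
      (fun x => gaus (5 / 2) x * e2pi (x * (ν₁ + ν₂ + ν₃ - ν))) (s - (y + s₀)),
      ← integral_const_mul, ← integral_const_mul]
    refine integral_congr_ae (Filter.Eventually.of_forall fun x => ?_)
    dsimp only
    have : e2pi (-(x * ν)) * e2pi ((x - 2 * s) * ν₃) * e2pi ((x - s) * ν₂) * e2pi ((x + s) * ν₁) =
        e2pi (s * (ν - 2 * ν₂ - 3 * ν₃)) * e2pi ((y + s₀) * (ν₁ + ν₂ + ν₃ - ν)) *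
        e2pi ((x + (s - (y + s₀))) * (ν₁ + ν₂ + ν₃ - ν)) := by
      simp only [← e2pi_add]
      congr 1
      ring
    linear_combination (k s * gaus 1 (s - s₀) * gaus (5 / 2) (x + (s - (y + s₀)))) * this
  rw [e2, enorm_mul, enorm_mul, enorm_e2pi, one_mul, freqDecay]
  gcongr
  rw [← ofReal_norm]
  exact ENNReal.ofReal_le_ofReal (hB _ _)

theorem norm_schwartz_mul₃_le (f g h : SchwartzMap ℝ ℂ) (x y z : ℝ) :
    ‖f x * g y * h z‖ ≤ (∫ ν, ‖FT1 f ν‖) * (∫ ν, ‖FT1 g ν‖) * (∫ ν, ‖FT1 h ν‖) := by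
  have hbd : ∀ (u : SchwartzMap ℝ ℂ) (x : ℝ), ‖u x‖ ≤ ∫ ν, ‖FT1 u ν‖ := fun u =>
    (isInvFT_schwartz u).norm_le
  have hn : ∀ u : SchwartzMap ℝ ℂ, 0 ≤ ∫ ν, ‖FT1 u ν‖ := fun u =>
    integral_nonneg fun _ => norm_nonneg _
  rw [norm_mul, norm_mul]
  exact mul_le_mul (mul_le_mul (hbd f x) (hbd g y) (norm_nonneg _) (hn f)) (hbd h z)
    (norm_nonneg _) (mul_nonneg (hn f) (hn g))

theorem STFT_trilMul_eq {k m : ℝ → ℂ} (hk : IsInvFT k m) (f g h : SchwartzMap ℝ ℂ) (y ν : ℝ) :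
    (√(Real.pi / 9) : ℝ) * STFT1 (gaus 5) (trilMul m f g h) y ν =
      ∫ s₀, locPiece k f g h y ν s₀ := by
  have hW0 := integrable_shear (φ := fun _ => -y) hk.integrable
    (integrable_gaus (b := 5) (by norm_num)) (continuous_gaus _).measurable measurable_const
  have hW : Integrable fun w : ℝ × ℝ => k w.1 * gaus 5 (w.2 - y) *
      (f (w.2 + w.1) * g (w.2 - w.1) * h (w.2 - 2 * w.1)) * e2pi (-(w.2 * ν)) := by
    have hP : AEStronglyMeasurable (fun w : ℝ × ℝ =>
        f (w.2 + w.1) * g (w.2 - w.1) * h (w.2 - 2 * w.1)) volume := by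
      have hf := f.continuous
      have hg := g.continuous
      have hh := h.continuous
      exact Continuous.aestronglyMeasurable (by fun_prop)
    have hW1 := hW0.mul_bdd hP (Filter.Eventually.of_forall fun w => norm_schwartz_mul₃_le f g h _ _ _)
    exact hW1.mul_bdd (c := 1)
      (by fun_prop : Continuous fun w : ℝ × ℝ => e2pi (-(w.2 * ν))).aestronglyMeasurable
      (Filter.Eventually.of_forall fun w => (norm_e2pi _).le)
  have e1 : STFT1 (gaus 5) (trilMul m f g h) y ν = ∫ w : ℝ × ℝ, k w.1 * gaus 5 (w.2 - y) *
      (f (w.2 + w.1) * g (w.2 - w.1) * h (w.2 - 2 * w.1)) * e2pi (-(w.2 * ν)) := by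
    rw [Measure.volume_eq_prod, integral_prod_symm _ hW]
    refine integral_congr_ae (Filter.Eventually.of_forall fun x => ?_)
    dsimp only
    rw [trilMul_eq_integral hk, ← integral_mul_const, ← integral_mul_const]
    refine integral_congr_ae (Filter.Eventually.of_forall fun s => ?_)
    dsimp only
    ring
  have hprod := integrable_shear hW (integrable_gaus (b := 9) (by norm_num))
    (continuous_gaus _).measurable (measurable_fst.neg : Measurable fun w : ℝ × ℝ => -w.1)
  have hswap := integral_integral_swap (μ := (volume : Measure (ℝ × ℝ))) (ν := volume)
    (f := fun w s₀ => k w.1 * gaus 5 (w.2 - y) *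
      (f (w.2 + w.1) * g (w.2 - w.1) * h (w.2 - 2 * w.1)) * e2pi (-(w.2 * ν)) *
      gaus 9 (s₀ + -w.1)) hprod
  simp_rw [integral_const_mul, ← sub_eq_add_neg] at hswap
  rw [e1, ← integral_const_mul]
  refine Eq.trans (integral_congr_ae (Filter.Eventually.of_forall fun w => ?_)) hswap
  dsimp only
  rw [integral_sub_right_eq_self (gaus 9), integral_gaus]
  ring

theorem lintegral_mul_le_eNorm {α : Type*} [MeasurableSpace α] (μ : Measure α) {q q' : ℝ≥0∞}
    (hqc : 1 / q + 1 / q' = 1) {F G : α → ℝ≥0∞} (hF : Measurable F) (hG : Measurable G) :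
    ∫⁻ a, F a * G a ∂μ ≤ eNorm μ q F * eNorm μ q' G := by
  have key : ∀ F G : α → ℝ≥0∞, Measurable G → ∫⁻ a, F a * G a ∂μ ≤ essSup F μ * ∫⁻ a, G a ∂μ := by
    intro F G hG
    rw [← lintegral_const_mul _ hG]
    refine lintegral_mono_ae ?_
    filter_upwards [ENNReal.ae_le_essSup F] with a ha
    gcongr
  rcases eq_or_ne q ∞ with rfl | hq
  · have : q' = 1 := by simpa using hqc
    subst this
    simpa [eNorm] using key F G hG
  rcases eq_or_ne q' ∞ with rfl | hq'
  · have : q = 1 := by simpa using hqc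
    subst this
    simpa [eNorm, mul_comm] using key G F hF
  have hpq : q.toReal.HolderConjugate q'.toReal := by
    have : q.HolderConjugate q' := ⟨by simpa using hqc⟩
    exact ENNReal.HolderConjugate.toReal_of_ne_top hq hq'
  simpa [eNorm, hq, hq'] using ENNReal.lintegral_mul_le_Lp_mul_Lq μ hpq hF.aemeasurable hG.aemeasurable

theorem eNorm_comp_sub_right (F : ℝ → ℝ≥0∞) (a : ℝ) {p : ℝ≥0∞} (hp : p ≠ ∞) :
    eNorm volume p (fun x => F (x - a)) = eNorm volume p F := by
  simp only [eNorm, if_neg hp]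
  rw [lintegral_sub_right_eq_self (fun x => F x ^ p.toReal)]

theorem eNorm_comp_sub_left (F : ℝ → ℝ≥0∞) (hF : Measurable F) (a : ℝ) (q : ℝ≥0∞) :
    eNorm volume q (fun x => F (a - x)) = eNorm volume q F := by
  unfold eNorm
  split_ifs
  · have h := Measure.measurePreserving_sub_left (volume : Measure ℝ) a
    conv_rhs => rw [← h.map_eq]
    exact (essSup_map_measure_of_measurable hF h.measurable.aemeasurable).symm
  · rw [lintegral_sub_left_eq_self (fun x => F x ^ q.toReal)]

theorem lintegral_comp_two_mul_le {F : ℝ → ℝ≥0∞} (hF : Measurable F) (a : ℝ) :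
    ∫⁻ x, F (a - 2 * x) ≤ ∫⁻ x, F x := by
  rw [← lintegral_sub_left_eq_self F a,
    ← lintegral_map (f := fun x => F (a - x)) (g := fun x : ℝ => 2 * x) (by fun_prop) (by fun_prop),
    Real.map_volume_mul_left two_ne_zero, lintegral_smul_measure]
  refine mul_le_of_le_one_left' ?_
  rw [ENNReal.ofReal_le_one]
  norm_num [abs_of_pos]

theorem eNorm_comp_sub_two_mul_le {F : ℝ → ℝ≥0∞} (hF : Measurable F) (a : ℝ) {p : ℝ≥0∞}
    (hp : p ≠ ∞) : eNorm volume p (fun x => F (a - 2 * x)) ≤ eNorm volume p F := by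
  simp only [eNorm, if_neg hp]
  exact ENNReal.rpow_le_rpow (lintegral_comp_two_mul_le (hF.pow_const _) a) (by positivity)

theorem rpow_lintegral_mul_le {α : Type*} [MeasurableSpace α] (μ : Measure α) {r : ℝ} (hr : 1 < r)
    {K w : α → ℝ≥0∞} (hK : Measurable K) (hw : Measurable w) :
    (∫⁻ a, K a * w a ∂μ) ^ r ≤ (∫⁻ a, K a ∂μ) ^ (r - 1) * ∫⁻ a, K a * w a ^ r ∂μ := by
  have hr0 : 0 < r := one_pos.trans hr
  have h := ENNReal.lintegral_mul_le_Lp_mul_Lq (μ.withDensity K)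
    (Real.HolderConjugate.conjExponent hr) hw.aemeasurable (aemeasurable_const (b := (1 : ℝ≥0∞)))
  simp only [Pi.mul_apply, mul_one, ENNReal.one_rpow] at h
  rw [lintegral_withDensity_eq_lintegral_mul _ hK hw,
    lintegral_withDensity_eq_lintegral_mul _ hK (hw.pow_const r),
    lintegral_withDensity_eq_lintegral_mul _ hK measurable_const] at h
  simp only [Pi.mul_apply, mul_one] at h
  calc _ ≤ _ := ENNReal.rpow_le_rpow h hr0.le
    _ = _ := by
      rw [ENNReal.mul_rpow_of_nonneg _ _ hr0.le, ← ENNReal.rpow_mul, ← ENNReal.rpow_mul,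
        one_div_mul_cancel hr0.ne', ENNReal.rpow_one, mul_comm, Real.conjExponent]
      congr 2
      field_simp

theorem lintegral_rpow_mixed_le {r : ℝ} (hr : 1 < r) {D : ℝ → ℝ → ℝ≥0∞}
    (hD : Measurable (Function.uncurry D)) {ρ w : ℝ → ℝ≥0∞} (hρ : Measurable ρ) (hw : Measurable w)
    {M : ℝ≥0∞} (h₁ : ∀ y, ∫⁻ s, D y s ≤ M) (h₂ : ∀ s, ∫⁻ y, D y s ≤ M) :
    ∫⁻ x, (∫⁻ y, ∫⁻ s, ρ (y - x) * D y s * w s) ^ r ≤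
      ((∫⁻ y, ρ y) * M) ^ r * ∫⁻ s, w s ^ r := by
  have hD' : Measurable fun z : ℝ × ℝ => D z.1 z.2 := hD
  have hr0 : 0 < r := one_pos.trans hr
  have hK : ∀ x, Measurable fun z : ℝ × ℝ => ρ (z.1 - x) * D z.1 z.2 := fun x => by fun_prop
  have hρM : ∀ x, ∫⁻ z : ℝ × ℝ, ρ (z.1 - x) * D z.1 z.2 ≤ (∫⁻ y, ρ y) * M := by
    intro x
    rw [Measure.volume_eq_prod, lintegral_prod _ (hK x).aemeasurable,
      ← lintegral_sub_right_eq_self ρ x, ← lintegral_mul_const _ (by fun_prop)]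
    refine lintegral_mono fun y => ?_
    dsimp only
    rw [lintegral_const_mul _ (by fun_prop)]
    gcongr
    exact h₁ y
  calc ∫⁻ x, (∫⁻ y, ∫⁻ s, ρ (y - x) * D y s * w s) ^ r
      ≤ ∫⁻ x, ((∫⁻ y, ρ y) * M) ^ (r - 1) *
          ∫⁻ z : ℝ × ℝ, ρ (z.1 - x) * D z.1 z.2 * w z.2 ^ r := by
        refine lintegral_mono fun x => ?_
        have := rpow_lintegral_mul_le volume hr (hK x) (hw.comp measurable_snd)
        rw [Measure.volume_eq_prod, lintegral_prod _
          (by fun_prop : Measurable fun z : ℝ × ℝ => ρ (z.1 - x) * D z.1 z.2 *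
            (w ∘ Prod.snd) z).aemeasurable] at this
        refine this.trans ?_
        gcongr ?_ * _
        exact ENNReal.rpow_le_rpow (hρM x) (by linarith)
    _ = ((∫⁻ y, ρ y) * M) ^ (r - 1) *
          ∫⁻ z : ℝ × ℝ, (∫⁻ x, ρ (z.1 - x)) * (D z.1 z.2 * w z.2 ^ r) := by
        rw [lintegral_const_mul _ (by fun_prop), lintegral_lintegral_swap (by fun_prop)]
        refine congrArg _ (lintegral_congr fun z => ?_)
        rw [← lintegral_mul_const _ (by fun_prop)]
        simp only [mul_assoc]
    _ = ((∫⁻ y, ρ y) * M) ^ (r - 1) * ((∫⁻ x, ρ x) *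
          ∫⁻ s, (∫⁻ y, D y s) * w s ^ r) := by
        simp_rw [lintegral_sub_left_eq_self ρ]
        rw [lintegral_const_mul _ (by fun_prop), Measure.volume_eq_prod,
          lintegral_prod_symm _ (by fun_prop)]
        refine congrArg _ (congrArg _ (lintegral_congr fun s => ?_))
        dsimp only
        rw [lintegral_mul_const _ (by fun_prop)]
    _ ≤ ((∫⁻ y, ρ y) * M) ^ (r - 1) * ((∫⁻ x, ρ x) * (M * ∫⁻ s, w s ^ r)) := by
        rw [← lintegral_const_mul M (hw.pow_const r)]
        exact mul_le_mul' le_rfl (mul_le_mul' le_rfl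
          (lintegral_mono fun s => mul_le_mul' (h₂ s) le_rfl))
    _ = _ := by
        rw [← mul_assoc (∫⁻ x, ρ x), ← mul_assoc]
        congr 1
        nth_rw 2 [← ENNReal.rpow_one ((∫⁻ x, ρ x) * M)]
        rw [← ENNReal.rpow_add_of_nonneg _ _ (by linarith) zero_le_one, sub_add_cancel]

theorem measurable_eNorm {p : ℝ≥0∞} (hp : p ≠ ∞) {u : ℝ → ℝ → ℝ≥0∞}
    (hu : Measurable (Function.uncurry u)) : Measurable fun ν => eNorm volume p fun s => u s ν := by
  have hu' : Measurable fun z : ℝ × ℝ => u z.1 z.2 := hu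
  simp only [eNorm, if_neg hp]
  exact (Measurable.lintegral_prod_left' (f := fun z : ℝ × ℝ => u z.1 z.2 ^ p.toReal)
    (by fun_prop)).pow_const _

theorem lintegral_mixed_le {p p' q q' : ℝ≥0∞}
    (hpc : 1 / p + 1 / p' = 1) (hqc : 1 / q + 1 / q' = 1) {u v : ℝ → ℝ → ℝ≥0∞}
    (hu : Measurable (Function.uncurry u)) (hv : Measurable (Function.uncurry v))
    {Φ : ℝ → ℝ≥0∞} (hΦ : Measurable Φ) (ν : ℝ) {G H : ℝ → ℝ≥0∞} (hGm : Measurable G)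
    (hHm : Measurable H) (hG : ∀ ν, eNorm volume p (fun s => u s ν) ≤ G ν)
    (hH : ∀ ν, eNorm volume p' (fun s => v s ν) ≤ H ν) :
    ∫⁻ s, ∫⁻ ν₃, v s ν₃ * ∫⁻ ν₂, u s ν₂ * Φ (ν₂ + ν₃ - ν) ≤
      (∫⁻ τ, Φ τ) * (eNorm volume q G * eNorm volume q' H) := by
  have hu' : Measurable fun z : ℝ × ℝ => u z.1 z.2 := hu
  have hv' : Measurable fun z : ℝ × ℝ => v z.1 z.2 := hv
  have hshift : ∀ τ, eNorm volume q (fun ν₃ => G (τ + ν - ν₃)) = eNorm volume q G := by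
    intro τ
    exact eNorm_comp_sub_left G hGm _ q
  calc ∫⁻ s, ∫⁻ ν₃, v s ν₃ * ∫⁻ ν₂, u s ν₂ * Φ (ν₂ + ν₃ - ν)
      = ∫⁻ s, ∫⁻ ν₃, ∫⁻ ν₂, v s ν₃ * u s ν₂ * Φ (ν₂ + ν₃ - ν) := by
        refine lintegral_congr fun s => lintegral_congr fun ν₃ => ?_
        rw [← lintegral_const_mul _ (by fun_prop)]
        simp only [mul_assoc]
    _ = ∫⁻ ν₃, ∫⁻ s, ∫⁻ ν₂, v s ν₃ * u s ν₂ * Φ (ν₂ + ν₃ - ν) := by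
        refine lintegral_lintegral_swap (Measurable.aemeasurable ?_)
        exact Measurable.lintegral_prod_right' (f := fun z : (ℝ × ℝ) × ℝ =>
          v z.1.1 z.1.2 * u z.1.1 z.2 * Φ (z.2 + z.1.2 - ν)) (by fun_prop)
    _ = ∫⁻ ν₃, ∫⁻ ν₂, ∫⁻ s, v s ν₃ * u s ν₂ * Φ (ν₂ + ν₃ - ν) :=
        lintegral_congr fun ν₃ => lintegral_lintegral_swap (by fun_prop)
    _ ≤ ∫⁻ ν₃, ∫⁻ ν₂, H ν₃ * G ν₂ * Φ (ν₂ + ν₃ - ν) := by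
        refine lintegral_mono fun ν₃ => lintegral_mono fun ν₂ => ?_
        dsimp only
        rw [lintegral_mul_const _ (by fun_prop)]
        gcongr
        simp_rw [mul_comm (v _ _), mul_comm (H ν₃)]
        refine (lintegral_mul_le_eNorm volume hpc (by fun_prop) (by fun_prop)).trans ?_
        gcongr
        exacts [hG ν₂, hH ν₃]
    _ = ∫⁻ ν₃, ∫⁻ τ, Φ τ * (G (τ + ν - ν₃) * H ν₃) := by
        refine lintegral_congr fun ν₃ => ?_
        rw [← lintegral_add_right_eq_self _ (ν - ν₃)]
        refine lintegral_congr fun τ => ?_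
        rw [show τ + (ν - ν₃) + ν₃ - ν = τ by ring, ← add_sub_assoc]
        ring
    _ = ∫⁻ τ, Φ τ * ∫⁻ ν₃, G (τ + ν - ν₃) * H ν₃ := by
        rw [lintegral_lintegral_swap (by fun_prop)]
        refine lintegral_congr fun τ => ?_
        rw [lintegral_const_mul _ (by fun_prop)]
    _ ≤ ∫⁻ τ, Φ τ * (eNorm volume q G * eNorm volume q' H) := by
        gcongr with τ
        exact (lintegral_mul_le_eNorm volume hqc (by fun_prop) hHm).trans_eq (by rw [hshift])
    _ = _ := by rw [lintegral_mul_const _ hΦ]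

theorem norm_TH_le (f g h : SchwartzMap ℝ ℂ) (x : ℝ) :
    ‖TH f g h x‖ ≤
      Real.pi * ∫ ξ : ℝ × ℝ × ℝ, ‖FT1 f ξ.1 * (FT1 g ξ.2.1 * FT1 h ξ.2.2)‖ :=
  norm_trilMul_le norm_sign_symb_le f g h x

theorem measurable_TH (f g h : SchwartzMap ℝ ℂ) : Measurable (TH f g h) :=
  measurable_trilMul measurable_sign_symb f g h

theorem exists_enorm_STFT_TH_le : ∃ C : ℝ, 0 < C ∧ ∀ (f g h : SchwartzMap ℝ ℂ) (y ν : ℝ),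
    ENNReal.ofReal (√(Real.pi / 9)) * ‖STFT1 (gaus 5) (TH f g h) y ν‖ₑ ≤
      ∫⁻ s₀ : ℝ, ∫⁻ ν₃, ‖STFT1 (gaus 1) h (y - 2 * s₀) ν₃‖ₑ *
        ∫⁻ ν₂, ‖STFT1 (gaus 1) g (y - s₀) ν₂‖ₑ *
          ∫⁻ ν₁, ‖STFT1 (gaus (1 / 2)) f (y + s₀) ν₁‖ₑ *
            (ENNReal.ofReal (C / (1 + |s₀|)) * freqDecay (ν₁ + ν₂ + ν₃ - ν)) := by
  obtain ⟨C, hC, hk⟩ := exists_norm_integral_truncKer_le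
  refine ⟨C, hC, fun f g h y ν => ?_⟩
  have hα : ∀ n : ℕ, 0 < 1 / ((n : ℝ) + 1) := fun n => by positivity
  have hβ : ∀ n : ℕ, 0 < (n : ℝ) + 1 := fun n => by positivity
  have hm : ∀ n : ℕ, Measurable (truncSymb (1 / ((n : ℝ) + 1)) ((n : ℝ) + 1)) := fun n =>
    (continuous_truncSymb _ _).measurable
  have hle : ∀ (n : ℕ) η, ‖truncSymb (1 / ((n : ℝ) + 1)) ((n : ℝ) + 1) η‖ ≤ Real.pi := fun n =>
    norm_truncSymb_le (hα n) (hβ n)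
  have hlim := tendsto_STFT (fun n => measurable_trilMul (hm n) f g h)
    (fun n x => norm_trilMul_le (hle n) f g h x)
    (fun x => tendsto_trilMul hm hle tendsto_truncSymb f g h x) (b := 5) (by norm_num) y ν
  rw [← TH_eq_trilMul] at hlim
  have e : ENNReal.ofReal (√(Real.pi / 9)) * ‖STFT1 (gaus 5) (TH f g h) y ν‖ₑ =
      ‖(√(Real.pi / 9) : ℝ) * STFT1 (gaus 5) (TH f g h) y ν‖ₑ := by
    rw [enorm_mul, ← ofReal_norm (((√(Real.pi / 9) : ℝ)) : ℂ), Complex.norm_real,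
      Real.norm_of_nonneg (Real.sqrt_nonneg _)]
  rw [e]
  refine le_of_tendsto' (hlim.const_mul _).enorm fun n => ?_
  rw [STFT_trilMul_eq (isInvFT_truncSymb (hα n) (hβ n))]
  refine (enorm_integral_le_lintegral_enorm _).trans (lintegral_mono fun s₀ => ?_)
  exact enorm_locPiece_le (isInvFT_truncSymb (hα n) (hβ n))
    (fun s₀ η => hk _ _ (hα n) (hβ n) s₀ η) f g h y ν s₀

theorem lintegral_enorm_gaus_ne_top {b : ℝ} (hb : 0 < b) : ∫⁻ x, ‖gaus b x‖ₑ ≠ ∞ :=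
  (integrable_gaus hb).2.ne

theorem freqDecay_eq : freqDecay = fun ω =>
    ‖(√(Real.pi / (5 / 2)) : ℝ) * gaus (Real.pi ^ 2 / (5 / 2)) ω‖ₑ := by
  funext ω
  rw [freqDecay, integral_gaus_e2pi (by norm_num)]

theorem measurable_freqDecay : Measurable freqDecay := by
  rw [freqDecay_eq]
  have := continuous_gaus (Real.pi ^ 2 / (5 / 2))
  exact (by fun_prop : Continuous fun ω =>
    (√(Real.pi / (5 / 2)) : ℝ) * gaus (Real.pi ^ 2 / (5 / 2)) ω).measurable.enorm

theorem lintegral_freqDecay_ne_top : ∫⁻ ω, freqDecay ω ≠ ∞ := by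
  rw [freqDecay_eq]
  exact ((integrable_gaus (by positivity)).const_mul _).2.ne

theorem exists_STFT_half_le {p : ℝ≥0∞} (hp : 1 < p) (hp_top : p < ∞) :
    ∃ c : ℝ≥0∞, c ≠ ∞ ∧ ∀ (f : SchwartzMap ℝ ℂ) (t ν : ℝ), ‖STFT1 (gaus (1 / 2)) f t ν‖ₑ ≤
      c * eNorm volume p fun y => ‖STFT1 (gaus 1) f y ν‖ₑ := by
  have hr : 1 < p.toReal := by
    rw [← ENNReal.toReal_one]
    exact (ENNReal.toReal_lt_toReal ENNReal.one_ne_top hp_top.ne).2 hp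
  have hr0 : 0 < p.toReal := one_pos.trans hr
  refine ⟨ENNReal.ofReal (√(Real.pi / (1 + 1)))⁻¹ *
    ((∫⁻ x, ‖gaus 1 x‖ₑ) ^ (p.toReal - 1)) ^ (1 / p.toReal), ?_, fun f t ν => ?_⟩
  · exact ENNReal.mul_ne_top ENNReal.ofReal_ne_top (ENNReal.rpow_ne_top_of_nonneg (by positivity)
      (ENNReal.rpow_ne_top_of_nonneg (by linarith) (lintegral_enorm_gaus_ne_top one_pos)))
  have hK : Measurable fun y => ‖gaus 1 (y - t)‖ₑ :=
    (by fun_prop : Continuous fun y => gaus 1 (y - t)).measurable.enorm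
  have hV : Measurable fun y => ‖STFT1 (gaus 1) f y ν‖ₑ :=
    ((stronglyMeasurable_STFT f f.continuous.measurable 1).measurable.comp
      (by fun_prop : Measurable fun y : ℝ => (y, ν))).enorm
  have h1 := enorm_STFT_widen_le f.continuous.measurable (isInvFT_schwartz f).norm_le
    (a := 1) (b := 1) one_pos one_pos t ν
  rw [show (1 : ℝ) * 1 / (1 + 1) = 1 / 2 by norm_num] at h1
  refine h1.trans ?_
  rw [mul_assoc]
  gcongr
  have h2 := rpow_lintegral_mul_le volume hr hK hV
  rw [lintegral_sub_right_eq_self (fun y => ‖gaus 1 y‖ₑ)] at h2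
  rw [← ENNReal.rpow_le_rpow_iff hr0, eNorm, if_neg hp_top.ne, ← ENNReal.mul_rpow_of_nonneg _ _
    (by positivity), ← ENNReal.rpow_mul, one_div_mul_cancel hr0.ne', ENNReal.rpow_one]
  refine h2.trans ?_
  gcongr with y
  refine mul_le_of_le_one_left' ?_
  rw [← ofReal_norm, ENNReal.ofReal_le_one]
  exact norm_gaus_le zero_le_one _

theorem lintegral_japanese_rpow_ne_top (C : ℝ) {r : ℝ} (hr : 1 < r) :
    ∫⁻ s : ℝ, ENNReal.ofReal (C / (1 + |s|)) ^ r ≠ ∞ := by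
  have hr0 : 0 < r := one_pos.trans hr
  have hi : Integrable fun s : ℝ => (1 + ‖s‖) ^ (-r) := integrable_one_add_norm (by simpa using hr)
  have : ∀ s : ℝ, ENNReal.ofReal (C / (1 + |s|)) ^ r =
      ENNReal.ofReal C ^ r * ENNReal.ofReal ((1 + ‖s‖) ^ (-r)) := by
    intro s
    have hs : 0 < 1 + |s| := by positivity
    rw [div_eq_mul_inv, ENNReal.ofReal_mul' (by positivity),
      ENNReal.mul_rpow_of_nonneg _ _ hr0.le, Real.norm_eq_abs, Real.rpow_neg hs.le,
      ← Real.inv_rpow hs.le, ENNReal.ofReal_rpow_of_nonneg (inv_nonneg.2 hs.le) hr0.le]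
  simp_rw [this]
  rw [lintegral_const_mul' _ _ (ENNReal.rpow_ne_top_of_nonneg hr0.le ENNReal.ofReal_ne_top)]
  exact ENNReal.mul_ne_top (ENNReal.rpow_ne_top_of_nonneg hr0.le ENNReal.ofReal_ne_top)
    hi.lintegral_lt_top.ne

theorem lintegral_freq_conv {A φ : ℝ → ℝ≥0∞} (hA : Measurable A) (hφ : Measurable φ) :
    ∫⁻ μ, ∫⁻ ν, A ν * φ (ν + μ) = (∫⁻ ν, A ν) * ∫⁻ ω, φ ω := by
  rw [lintegral_lintegral_swap (by fun_prop), ← lintegral_mul_const _ hA]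
  refine lintegral_congr fun ν => ?_
  rw [lintegral_const_mul _ (by fun_prop), lintegral_add_left_eq_self φ ν]

/-- The frequency-integrated interaction density of `g` and `h`, at time `y` and offset `s`. -/
def interaction (u v : ℝ → ℝ → ℝ≥0∞) (Φ : ℝ → ℝ≥0∞) (ν y s : ℝ) : ℝ≥0∞ :=
  ∫⁻ ν₃, v (y - 2 * s) ν₃ * ∫⁻ ν₂, u (y - s) ν₂ * Φ (ν₂ + ν₃ - ν)

theorem measurable_interaction {u v : ℝ → ℝ → ℝ≥0∞} (hu : Measurable (Function.uncurry u))
    (hv : Measurable (Function.uncurry v)) {Φ : ℝ → ℝ≥0∞} (hΦ : Measurable Φ) (ν : ℝ) :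
    Measurable (Function.uncurry (interaction u v Φ ν)) := by
  have hu' : Measurable fun z : ℝ × ℝ => u z.1 z.2 := hu
  have hv' : Measurable fun z : ℝ × ℝ => v z.1 z.2 := hv
  have h1 : Measurable fun z : (ℝ × ℝ) × ℝ => ∫⁻ ν₂, u (z.1.1 - z.1.2) ν₂ * Φ (ν₂ + z.2 - ν) :=
    Measurable.lintegral_prod_right' (f := fun z : ((ℝ × ℝ) × ℝ) × ℝ =>
      u (z.1.1.1 - z.1.1.2) z.2 * Φ (z.2 + z.1.2 - ν)) (by fun_prop)
  exact Measurable.lintegral_prod_right' (f := fun z : (ℝ × ℝ) × ℝ =>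
    v (z.1.1 - 2 * z.1.2) z.2 * ∫⁻ ν₂, u (z.1.1 - z.1.2) ν₂ * Φ (ν₂ + z.2 - ν))
    (by fun_prop)

theorem lintegral_interaction_offset_le {p p' q q' : ℝ≥0∞} (hp : p ≠ ∞) (hp' : p' ≠ ∞)
    (hpc : 1 / p + 1 / p' = 1) (hqc : 1 / q + 1 / q' = 1) {u v : ℝ → ℝ → ℝ≥0∞}
    (hu : Measurable (Function.uncurry u)) (hv : Measurable (Function.uncurry v))
    {Φ : ℝ → ℝ≥0∞} (hΦ : Measurable Φ) (ν y : ℝ) :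
    ∫⁻ s, interaction u v Φ ν y s ≤ (∫⁻ τ, Φ τ) *
      (eNorm volume q (fun ν => eNorm volume p fun s => u s ν) *
        eNorm volume q' (fun ν => eNorm volume p' fun s => v s ν)) := by
  have hu' : Measurable fun z : ℝ × ℝ => u z.1 z.2 := hu
  have hv' : Measurable fun z : ℝ × ℝ => v z.1 z.2 := hv
  exact lintegral_mixed_le hpc hqc (u := fun s ν => u (y - s) ν) (v := fun s ν => v (y - 2 * s) ν)
    (by unfold Function.uncurry; fun_prop) (by unfold Function.uncurry; fun_prop) hΦ ν
    (measurable_eNorm hp hu) (measurable_eNorm hp' hv)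
    (fun ν => (eNorm_comp_sub_left (fun s => u s ν) (by fun_prop) y p).le)
    (fun ν => eNorm_comp_sub_two_mul_le (F := fun s => v s ν) (by fun_prop) y hp')

theorem lintegral_interaction_time_le {p p' q q' : ℝ≥0∞} (hp : p ≠ ∞) (hp' : p' ≠ ∞)
    (hpc : 1 / p + 1 / p' = 1) (hqc : 1 / q + 1 / q' = 1) {u v : ℝ → ℝ → ℝ≥0∞}
    (hu : Measurable (Function.uncurry u)) (hv : Measurable (Function.uncurry v))
    {Φ : ℝ → ℝ≥0∞} (hΦ : Measurable Φ) (ν s : ℝ) :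
    ∫⁻ y, interaction u v Φ ν y s ≤ (∫⁻ τ, Φ τ) *
      (eNorm volume q (fun ν => eNorm volume p fun s => u s ν) *
        eNorm volume q' (fun ν => eNorm volume p' fun s => v s ν)) := by
  have hu' : Measurable fun z : ℝ × ℝ => u z.1 z.2 := hu
  have hv' : Measurable fun z : ℝ × ℝ => v z.1 z.2 := hv
  exact lintegral_mixed_le hpc hqc (u := fun y ν => u (y - s) ν) (v := fun y ν => v (y - 2 * s) ν)
    (by unfold Function.uncurry; fun_prop) (by unfold Function.uncurry; fun_prop) hΦ ν
    (measurable_eNorm hp hu) (measurable_eNorm hp' hv)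
    (fun ν => (eNorm_comp_sub_right (fun y => u y ν) s hp).le)
    (fun ν => (eNorm_comp_sub_right (fun y => v y ν) (2 * s) hp').le)

theorem measurable_enorm_STFT (f : SchwartzMap ℝ ℂ) (b : ℝ) :
    Measurable (Function.uncurry fun t ν => ‖STFT1 (gaus b) f t ν‖ₑ) :=
  (stronglyMeasurable_STFT f f.continuous.measurable b).enorm

/-- Pointwise control of the short-time Fourier transform of `TH f g h`. -/
theorem exists_enorm_STFT_TH_le_interaction {p₁ : ℝ≥0∞} (hp₁ : 1 < p₁) (hp₁_top : p₁ < ∞) :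
    ∃ C : ℝ, ∃ c : ℝ≥0∞, c ≠ ∞ ∧ ∀ f g h : SchwartzMap ℝ ℂ, ∃ Φ : ℝ → ℝ≥0∞, Measurable Φ ∧
      ∫⁻ τ, Φ τ ≤ c * modNorm1 p₁ 1 f ∧ ∀ x ν, ‖STFT1 (gaus 1) (TH f g h) x ν‖ₑ ≤
        ∫⁻ y, ∫⁻ s : ℝ, ‖gaus (5 / 4) (y - x)‖ₑ *
          interaction (fun t ν => ‖STFT1 (gaus 1) g t ν‖ₑ) (fun t ν => ‖STFT1 (gaus 1) h t ν‖ₑ)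
            Φ ν y s * ENNReal.ofReal (C / (1 + |s|)) := by
  obtain ⟨C, -, hTH⟩ := exists_enorm_STFT_TH_le
  obtain ⟨c₁, hc₁, hf⟩ := exists_STFT_half_le hp₁ hp₁_top
  have h9 : 0 < √(Real.pi / 9) := Real.sqrt_pos.2 (by positivity)
  set c₂ := ENNReal.ofReal (√(Real.pi / (5 + 5 / 4)))⁻¹ with hc₂
  set c₃ := ENNReal.ofReal (√(Real.pi / 9))⁻¹ with hc₃
  refine ⟨C, c₂ * c₃ * c₁ * ∫⁻ ω, freqDecay ω, ?_, fun f g h => ?_⟩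
  · exact ENNReal.mul_ne_top (ENNReal.mul_ne_top (ENNReal.mul_ne_top ENNReal.ofReal_ne_top
      ENNReal.ofReal_ne_top) hc₁) lintegral_freqDecay_ne_top
  have hφ := measurable_freqDecay
  set A : ℝ → ℝ≥0∞ := fun ν => c₂ * c₃ * c₁ *
    eNorm volume p₁ fun y => ‖STFT1 (gaus 1) f y ν‖ₑ with hA
  have hAm : Measurable A :=
    (measurable_eNorm hp₁_top.ne (measurable_enorm_STFT f 1)).const_mul _
  refine ⟨fun μ => ∫⁻ ν, A ν * freqDecay (ν + μ), ?_, ?_, fun x ν => ?_⟩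
  · exact Measurable.lintegral_prod_right' (f := fun z : ℝ × ℝ => A z.2 * freqDecay (z.2 + z.1))
      (by fun_prop)
  · rw [lintegral_freq_conv hAm hφ, hA,
      lintegral_const_mul _ (measurable_eNorm hp₁_top.ne (measurable_enorm_STFT f 1)), modNorm1,
      gauss1_eq, eNorm, if_neg ENNReal.one_ne_top]
    simp only [ENNReal.toReal_one, ENNReal.rpow_one, div_one]
    rw [mul_right_comm]
    rfl
  have h1 := enorm_STFT_widen_le (measurable_TH f g h) (norm_TH_le f g h)
    (a := 5) (b := 5 / 4) (by norm_num) (by norm_num) x ν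
  rw [show (5 : ℝ) * (5 / 4) / (5 + 5 / 4) = 1 by norm_num] at h1
  refine h1.trans ?_
  rw [← lintegral_const_mul' _ _ ENNReal.ofReal_ne_top]
  refine lintegral_mono fun y => ?_
  have hk : c₂ * c₃ ≠ ∞ := ENNReal.mul_ne_top ENNReal.ofReal_ne_top ENNReal.ofReal_ne_top
  have h93 : c₃ * ENNReal.ofReal (√(Real.pi / 9)) = 1 := by
    rw [← ENNReal.ofReal_mul (by positivity), inv_mul_cancel₀ h9.ne', ENNReal.ofReal_one]
  dsimp only
  calc c₂ * (‖gaus (5 / 4) (y - x)‖ₑ * ‖STFT1 (gaus 5) (TH f g h) y ν‖ₑ)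
      = c₃ * ENNReal.ofReal (√(Real.pi / 9)) *
          (c₂ * (‖gaus (5 / 4) (y - x)‖ₑ * ‖STFT1 (gaus 5) (TH f g h) y ν‖ₑ)) := by
        rw [h93, one_mul]
    _ = ‖gaus (5 / 4) (y - x)‖ₑ * (c₂ * c₃ * (ENNReal.ofReal (√(Real.pi / 9)) *
          ‖STFT1 (gaus 5) (TH f g h) y ν‖ₑ)) := by ring
    _ ≤ ‖gaus (5 / 4) (y - x)‖ₑ * (c₂ * c₃ * _) :=
        mul_le_mul' le_rfl (mul_le_mul' le_rfl (hTH f g h y ν))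
    _ ≤ _ := by
      simp only [mul_assoc ‖gaus (5 / 4) (y - x)‖ₑ]
      rw [lintegral_const_mul' _ _ enorm_ne_top, ← lintegral_const_mul' _ _ hk]
      refine mul_le_mul' le_rfl (lintegral_mono fun s => ?_)
      dsimp only [interaction]
      rw [← lintegral_const_mul' _ _ hk, ← lintegral_mul_const' _ _ ENNReal.ofReal_ne_top]
      refine lintegral_mono fun ν₃ => ?_
      dsimp only
      rw [mul_left_comm, mul_assoc ‖STFT1 (gaus 1) h _ _‖ₑ, ← lintegral_const_mul' _ _ hk,
        ← lintegral_mul_const' _ _ ENNReal.ofReal_ne_top]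
      refine mul_le_mul' le_rfl (lintegral_mono fun ν₂ => ?_)
      dsimp only
      rw [mul_left_comm, mul_assoc ‖STFT1 (gaus 1) g _ _‖ₑ, ← lintegral_const_mul' _ _ hk,
        ← lintegral_mul_const' _ _ ENNReal.ofReal_ne_top]
      refine mul_le_mul' le_rfl (lintegral_mono fun ν₁ => ?_)
      dsimp only
      rw [← add_sub_assoc, ← add_assoc]
      calc _ ≤ c₂ * c₃ * (c₁ * (eNorm volume p₁ fun y => ‖STFT1 (gaus 1) f y ν₁‖ₑ) *
            (ENNReal.ofReal (C / (1 + |s|)) * freqDecay (ν₁ + ν₂ + ν₃ - ν))) := by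
            gcongr
            exact hf f _ ν₁
        _ = _ := by
            rw [hA]
            ring

theorem ne_top_of_one_lt_conj {p p' : ℝ≥0∞} (hp : 1 < p) (hpc : 1 / p + 1 / p' = 1) : p' ≠ ∞ := by
  rintro rfl
  simp only [one_div, ENNReal.inv_top, add_zero, ENNReal.inv_eq_one] at hpc
  exact hp.ne' hpc

/-- boundedness of the trilinear Hilbert transform on products of
modulation spaces. -/
theorem stmt19 (p p₀ p₁ q p' q' : ℝ≥0∞)
    (hp : 1 < p) (hp_top : p < ∞)
    (hp₀ : 1 < p₀) (hp₀_top : p₀ < ∞)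
    (hp₁ : 1 < p₁) (hp₁_top : p₁ < ∞)
    (hq : 1 ≤ q)
    (hpc : 1 / p + 1 / p' = 1) (hqc : 1 / q + 1 / q' = 1) :
    ∃ C : ℝ≥0, 0 < C ∧
      ∀ f g h : SchwartzMap ℝ ℂ,
        modNorm1 p₀ ∞ (TH (⇑f) (⇑g) (⇑h)) ≤
          (C : ℝ≥0∞) * modNorm1 p₁ 1 (⇑f) * modNorm1 p q (⇑g) * modNorm1 p' q' (⇑h) := by
  obtain ⟨C, c, hc, H⟩ := exists_enorm_STFT_TH_le_interaction hp₁ hp₁_top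
  have hr : 1 < p₀.toReal := by
    rw [← ENNReal.toReal_one]
    exact (ENNReal.toReal_lt_toReal ENNReal.one_ne_top hp₀_top.ne).2 hp₀
  have hr0 : 0 < p₀.toReal := one_pos.trans hr
  have hp' : p' ≠ ∞ := ne_top_of_one_lt_conj hp hpc
  set W := ∫⁻ s : ℝ, ENNReal.ofReal (C / (1 + |s|)) ^ p₀.toReal with hW
  set R := ∫⁻ y, ‖gaus (5 / 4) y‖ₑ with hR
  have hK : R * c * W ^ (1 / p₀.toReal) ≠ ∞ :=
    ENNReal.mul_ne_top (ENNReal.mul_ne_top (lintegral_enorm_gaus_ne_top (by norm_num)) hc)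
      (ENNReal.rpow_ne_top_of_nonneg (by positivity) (lintegral_japanese_rpow_ne_top C hr))
  refine ⟨(R * c * W ^ (1 / p₀.toReal)).toNNReal + 1, by positivity, fun f g h => ?_⟩
  obtain ⟨Φ, hΦ, hΦle, hN⟩ := H f g h
  rw [ENNReal.coe_add, ENNReal.coe_toNNReal hK]
  set M := modNorm1 p₁ 1 f * modNorm1 p q g * modNorm1 p' q' h with hM
  have hρ : Measurable fun y => ‖gaus (5 / 4) y‖ₑ := (continuous_gaus _).measurable.enorm
  have hw : Measurable fun s : ℝ => ENNReal.ofReal (C / (1 + |s|)) := by fun_prop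
  have hΦM : (∫⁻ τ, Φ τ) * (modNorm1 p q g * modNorm1 p' q' h) ≤ c * M := by
    rw [hM, mul_assoc (modNorm1 p₁ 1 f), ← mul_assoc c]
    gcongr
  have key : ∀ ν, eNorm volume p₀ (fun t => ‖STFT1 gauss1 (TH f g h) t ν‖ₑ) ≤
      R * c * W ^ (1 / p₀.toReal) * M := by
    intro ν
    have hu := measurable_enorm_STFT g 1
    have hv := measurable_enorm_STFT h 1
    have hmix := lintegral_rpow_mixed_le hr (measurable_interaction hu hv hΦ ν) hρ hw (M := c * M)
      (fun y => (lintegral_interaction_offset_le hp_top.ne hp' hpc hqc hu hv hΦ ν y).trans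
        (by rw [← gauss1_eq]; exact hΦM))
      (fun s => (lintegral_interaction_time_le hp_top.ne hp' hpc hqc hu hv hΦ ν s).trans
        (by rw [← gauss1_eq]; exact hΦM))
    rw [gauss1_eq, eNorm, if_neg hp₀_top.ne]
    calc _ ≤ (((∫⁻ y, ‖gaus (5 / 4) y‖ₑ) * (c * M)) ^ p₀.toReal * W) ^ (1 / p₀.toReal) := by
          refine ENNReal.rpow_le_rpow (le_trans (lintegral_mono fun x => ?_) hmix) (by positivity)
          exact ENNReal.rpow_le_rpow (hN x ν) hr0.le
      _ = _ := by
          rw [ENNReal.mul_rpow_of_nonneg _ _ (by positivity), ← ENNReal.rpow_mul,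
            mul_one_div_cancel hr0.ne', ENNReal.rpow_one, ← hR]
          ring
  calc modNorm1 p₀ ∞ (TH f g h) ≤ R * c * W ^ (1 / p₀.toReal) * M := by
        rw [modNorm1, eNorm, if_pos rfl]
        exact essSup_le_of_ae_le _ (Filter.Eventually.of_forall key)
    _ ≤ (R * c * W ^ (1 / p₀.toReal) + (1 : ℝ≥0)) * M := by gcongr; exact le_self_add
    _ = _ := by rw [hM]; ring

end
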